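/- arXiv:1307.5293 — 4 statements merged into one kernel-verified Lean document; each statement's English description precedes it below -/
import Mathlib

section
/- Let p > 2, let Q_T ⊂ ℝ×ℝ^n be open, f ∈ L^p(Q_T;ℝ^{N×n}), let Q_{S,R}(t,x) := (t−S,t)×B_R(x) ⊂ Q_T with S, R > 0, and let b ∈ (0,2). Then there exists a function s : (0,R] → (0,S] such that, setting λ_r := (r²/s(r))^{1/(p−2)} and Q^{λ_r}_r := (t−s(r),t)×B_r(x), the following hold for all 0 < r < ρ ≤ R: (1) s(r) = λ_r^{2−p} r² and Q^{λ_r}_r ⊂ Q_T; (2) s(r) ≤ (r/ρ)^b s(ρ), s is continuous and strictly increasing with s(r) → 0 as r → 0, and Q^{λ_r}_r ⊂ Q^{λ_ρ}_ρ; (3) ⨍_{Q^{λ_r}_r} |f|^p dz ≤ λ_r^p (each cylinder is sub-intrinsic with respect to f); (4) if s(r) < (r/ρ)^b s(ρ), then there exists r₁ ∈ [r,ρ) with ⨍_{Q^{λ_{r₁}}_{r₁}} |f|^p dz = λ_{r₁}^p; (5) if ⨍_{Q^{λ_a}_a} |f|^p dz < λ_a^p for all a ∈ (r₁,ρ), then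 λ_a ≤ (a/ρ)^β λ_ρ for all a ∈ [r₁,ρ], where β := (2−b)/(p−2); (6) for all θ ∈ (0,1]: θ^β λ_r ≤ λ_{θr} ≤ c λ_r θ^{−(n+2)/2}; (7) for all θ ∈ (0,1]: |Q^{λ_{θr}}_{θr}|^{−1} ≤ c θ^{−(n+2)(1+(p−2)/2)} |Q^{λ_r}_r|^{−1}; (8) for all θ ∈ (0,1]: Q^{λ_{σr}}_{σr} ⊂ θQ^{λ_r}_r where σ = θ^{2/b}. The constant c depends only on n, N and p. -/
open MeasureTheory Metric Set Filter
open scoped ENNReal NNReal RealInnerProductSpace Topology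

noncomputable section

/-- `ℝ^n` with the Euclidean structure. -/
abbrev En (n : ℕ) : Type := EuclideanSpace ℝ (Fin n)

/-- `ℝ^{N×n}` (matrices) with the Euclidean (Frobenius) norm. -/
abbrev Mat (N n : ℕ) : Type := EuclideanSpace ℝ (Fin N × Fin n)

/-- The nonlinear quantity `V(Q) = |Q|^((p-2)/2) • Q`. -/
def Vmap (p : ℝ) {N n : ℕ} (Q : Mat N n) : Mat N n := ‖Q‖ ^ ((p - 2) / 2) • Q

/-- Spatial gradient (as a matrix) of `f : ℝ^n → ℝ^N` at `x`: entry `(i,j)` is `∂ⱼ fᶦ(x)`. -/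
def sgrad {n N : ℕ} (f : En n → En N) (x : En n) : Mat N n :=
  (EuclideanSpace.equiv (Fin N × Fin n) ℝ).symm fun q =>
    fderiv ℝ (fun y => f y q.1) x (EuclideanSpace.single q.2 1)

/-- The `λ`-scaled parabolic cylinder `Q^λ_r(t,x) = (t - λ^(2-p) r², t) × B_r(x)`. -/
def cylQ (p : ℝ) {n : ℕ} (lam r : ℝ) (z : ℝ × En n) : Set (ℝ × En n) :=
  Ioo (z.1 - lam ^ (2 - p) * r ^ 2) z.1 ×ˢ ball z.2 r

/-- The parabolic cylinder `Q_{s,r}(t,x) = (t - s, t) × B_r(x)`. -/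
def cylSR {n : ℕ} (s r : ℝ) (z : ℝ × En n) : Set (ℝ × En n) :=
  Ioo (z.1 - s) z.1 ×ˢ ball z.2 r

/-- `u` is a local weak (energy) solution of `∂ₜ u − div(|∇u|^(p−2)∇u) = −div g` on `U`,
with spatial weak gradient `Du`. -/
structure IsWeakSolution (p : ℝ) {n N : ℕ} (U : Set (ℝ × En n))
    (u : ℝ × En n → En N) (Du g : ℝ × En n → Mat N n) : Prop where
  open_dom : IsOpen U
  loc_u : LocallyIntegrableOn (fun z => ‖u z‖ ^ 2) U volume
  loc_Du : LocallyIntegrableOn (fun z => ‖Du z‖ ^ p) U volume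
  /-- `Du` is the spatial weak gradient of `u`. -/
  weak_grad : ∀ φ : ℝ × En n → ℝ, ContDiff ℝ (⊤ : ℕ∞) φ → HasCompactSupport φ →
    tsupport φ ⊆ U → ∀ (i : Fin N) (j : Fin n),
      ∫ z in U, Du z (i, j) * φ z
        = - ∫ z in U, u z i * fderiv ℝ (fun y => φ (z.1, y)) z.2 (EuclideanSpace.single j 1)
  /-- the distributional form of the equation. -/
  eqn : ∀ φ : ℝ × En n → En N, ContDiff ℝ (⊤ : ℕ∞) φ → HasCompactSupport φ →
    tsupport φ ⊆ U →
      ∫ z in U, ((inner ℝ ((‖Du z‖ ^ (p - 2) : ℝ) • Du z) (sgrad (fun y => φ (z.1, y)) z.2) : ℝ)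
          - (inner ℝ (u z) (deriv (fun s => φ (s, z.2)) z.1) : ℝ))
        = ∫ z in U, (inner ℝ (g z) (sgrad (fun y => φ (z.1, y)) z.2) : ℝ)

/-- `h` is `p`-caloric on `U` (with spatial weak gradient `Dh`). -/
def IsPCaloric (p : ℝ) {n N : ℕ} (U : Set (ℝ × En n))
    (h : ℝ × En n → En N) (Dh : ℝ × En n → Mat N n) : Prop :=
  IsWeakSolution p U h Dh 0

/-- BMO norm of `f` over a set `B'` of `ℝ^n`: sup over balls contained in `B'` of the
mean oscillation. -/
def bmoNorm {n : ℕ} {F : Type*} [NormedAddCommGroup F] [NormedSpace ℝ F]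
    (B' : Set (En n)) (f : En n → F) : ℝ≥0∞ :=
  ⨆ (y : En n) (ρ : ℝ) (_ : 0 < ρ) (_ : ball y ρ ⊆ B'),
    ENNReal.ofReal (⨍ x in ball y ρ, ‖f x - ⨍ w in ball y ρ, f w‖)

/-- weighted BMO norm of `f` over `B'` with weight `ω`. -/
def bmoNormW {n : ℕ} {F : Type*} [NormedAddCommGroup F] [NormedSpace ℝ F]
    (ω : ℝ → ℝ) (B' : Set (En n)) (f : En n → F) : ℝ≥0∞ :=
  ⨆ (y : En n) (ρ : ℝ) (_ : 0 < ρ) (_ : ball y ρ ⊆ B'),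
    ENNReal.ofReal ((⨍ x in ball y ρ, ‖f x - ⨍ w in ball y ρ, f w‖) / ω ρ)

/-- `L^∞(I, BMO(B'))` norm of `g`. -/
def linftyBmo {n : ℕ} {F : Type*} [NormedAddCommGroup F] [NormedSpace ℝ F]
    (I : Set ℝ) (B' : Set (En n)) (g : ℝ × En n → F) : ℝ≥0∞ :=
  essSup (fun t => bmoNorm B' fun x => g (t, x)) (volume.restrict I)

/-- `L^∞(I, BMO_ω(B'))` norm of `g`. -/
def linftyBmoW {n : ℕ} {F : Type*} [NormedAddCommGroup F] [NormedSpace ℝ F]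
    (ω : ℝ → ℝ) (I : Set ℝ) (B' : Set (En n)) (g : ℝ × En n → F) : ℝ≥0∞ :=
  essSup (fun t => bmoNormW ω B' fun x => g (t, x)) (volume.restrict I)

/-- essential oscillation of `f` over `E`. -/
def essOsc {α F : Type*} [MeasurableSpace α] [NormedAddCommGroup F]
    (μ : Measure α) (E : Set α) (f : α → F) : ℝ≥0∞ :=
  essSup (fun zw : α × α => ENNReal.ofReal ‖f zw.1 - f zw.2‖)
    ((μ.restrict E).prod (μ.restrict E))

/-- `λ_r = (r²/s(r))^(1/(p-2))`. -/
def lamOf (p : ℝ) (s : ℝ → ℝ) (r : ℝ) : ℝ := (r ^ 2 / s r) ^ (1 / (p - 2))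

/-- `st` is the function `s̃` of the intrinsic-family construction for `f` on
`Q_{S,R}(t,x)`: `s̃(a)` is the largest `s ∈ (0,S]` with
`(∫_{t-s}^t ∫_{B_a(x)} |f|^p)^(p-2) s² ≤ a^(2p) |B_a|^(p-2)`. -/
def IsTildeS (p : ℝ) {n N : ℕ} (S R : ℝ) (t : ℝ) (x : En n)
    (f : ℝ × En n → Mat N n) (st : ℝ → ℝ) : Prop :=
  ∀ a ∈ Ioc (0:ℝ) R, IsGreatest {s | s ∈ Ioc (0:ℝ) S ∧
    (∫ z in Ioo (t - s) t ×ˢ ball x a, ‖f z‖ ^ p) ^ (p - 2) * s ^ 2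
      ≤ a ^ (2 * p) * (volume (ball x a)).toReal ^ (p - 2)} (st a)

/-- `s(r) = min_{r ≤ a ≤ R} (r/a)^b s̃(a)`. -/
def IsSFun (b R : ℝ) (st s : ℝ → ℝ) : Prop :=
  ∀ r ∈ Ioc (0:ℝ) R, IsLeast {v | ∃ a ∈ Icc r R, v = (r / a) ^ b * st a} (s r)

/-- `α` is an exponent for the interior decay estimate for gradients of `p`-caloric maps
(Theorem `decay1`). -/
def IsDecayExponent (n N : ℕ) (p α : ℝ) : Prop :=
  α ∈ Ioo (0:ℝ) 1 ∧ ∀ K : ℝ, 1 ≤ K → ∃ c : ℝ, 0 < c ∧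
    ∀ (lam r : ℝ) (z : ℝ × En n) (h : ℝ × En n → En N) (Dh : ℝ × En n → Mat N n),
      0 < lam → 0 < r → IsPCaloric p (cylQ p lam r z) h Dh →
      (⨍ w in cylQ p lam r z, ‖Dh w‖ ^ p) ≤ (K * lam) ^ p →
      ∀ θ ∈ Ioc (0:ℝ) (1/4),
        essOsc volume (cylQ p lam (θ * r) z) (fun w => Vmap p (Dh w)) ^ 2
          ≤ ENNReal.ofReal (c * θ ^ α * lam ^ p)


theorem abs_family (S R b E : ℝ) (Φ : ℝ → ℝ → ℝ) (H : ℝ → ℝ)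
    (hS : 0 < S) (hb : 0 < b) (hbE : b ≤ E)
    (hΦc : Continuous (fun q : ℝ × ℝ => Φ q.1 q.2)) (hHc : Continuous H)
    (hΦ0 : ∀ a, Φ 0 a = 0)
    (hΦm : ∀ u a a', 0 ≤ u → a ≤ a' → Φ u a ≤ Φ u a')
    (hΦs : ∀ θ u a, 0 ≤ θ → θ ≤ 1 → 0 ≤ u → Φ (θ * u) a ≤ θ ^ 2 * Φ u a)
    (hHp : ∀ a, 0 < a → 0 < H a)
    (hHs : ∀ a ρ, 0 < a → a ≤ ρ → H a = ((a / ρ) ^ E) ^ 2 * H ρ) :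
    ∃ s : ℝ → ℝ,
      (∀ r ∈ Ioc (0:ℝ) R, 0 < s r ∧ s r ≤ S) ∧
      (∀ r ρ, 0 < r → r ≤ ρ → ρ ≤ R → s r ≤ (r / ρ) ^ b * s ρ) ∧
      (∀ r ρ, 0 < r → r ≤ ρ → ρ ≤ R → (r / ρ) ^ E * s ρ ≤ s r) ∧
      (∀ r ∈ Ioc (0:ℝ) R, Φ (s r) r ≤ H r) ∧
      (∀ r ρ, 0 < r → r ≤ ρ → ρ ≤ R → s r < (r / ρ) ^ b * s ρ →
        ∃ r₁ ∈ Ico r ρ, Φ (s r₁) r₁ = H r₁) := by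
  let C : ℝ → Set (ℝ × ℝ) := fun r =>
    (Icc r R ×ˢ Icc 0 S) ∩ ({q | H q.1 ≤ Φ q.2 q.1} ∪ {q | q.2 = S})
  have hCc : ∀ r, IsCompact (C r) := by
    intro r
    refine (isCompact_Icc.prod isCompact_Icc).inter_right (IsClosed.union ?_ ?_)
    · exact isClosed_le (hHc.comp continuous_fst) (hΦc.comp (continuous_snd.prodMk continuous_fst))
    · exact isClosed_eq continuous_snd continuous_const
  have hex : ∀ r, ∃ q : ℝ × ℝ, r ∈ Ioc (0:ℝ) R → q ∈ C r ∧
      ∀ q' ∈ C r, (r / q.1) ^ b * q.2 ≤ (r / q'.1) ^ b * q'.2 := by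
    intro r
    by_cases hr : r ∈ Ioc (0:ℝ) R
    · have hne : (C r).Nonempty := ⟨(r, S), ⟨⟨⟨le_rfl, hr.2⟩, ⟨hS.le, le_rfl⟩⟩, Or.inr rfl⟩⟩
      have hcont : ContinuousOn (fun q : ℝ × ℝ => (r / q.1) ^ b * q.2) (C r) := by
        intro q hq
        have hq1 : q.1 ≠ 0 := (hr.1.trans_le hq.1.1.1).ne'
        apply ContinuousAt.continuousWithinAt
        refine ContinuousAt.mul ?_ continuous_snd.continuousAt
        exact ContinuousAt.rpow_const (continuousAt_const.div continuous_fst.continuousAt hq1)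
          (Or.inr hb.le)
      obtain ⟨q, hq, hmin⟩ := (hCc r).exists_isMinOn hne hcont
      exact ⟨q, fun _ => ⟨hq, fun q' hq' => hmin hq'⟩⟩
    · exact ⟨0, fun h => absurd h hr⟩
  choose q hq using hex
  let s : ℝ → ℝ := fun r => (r / (q r).1) ^ b * (q r).2
  have hs : ∀ r ∈ Ioc (0:ℝ) R, ∃ a u, r ≤ a ∧ a ≤ R ∧ 0 < u ∧ u ≤ S ∧ (a, u) ∈ C a ∧
      s r = (r / a) ^ b * u := by
    intro r hr
    obtain ⟨h1, _⟩ := hq r hr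
    have ha : 0 < (q r).1 := hr.1.trans_le h1.1.1.1
    refine ⟨(q r).1, (q r).2, h1.1.1.1, h1.1.1.2, ?_, h1.1.2.2, ⟨⟨⟨le_rfl, h1.1.1.2⟩, h1.1.2⟩, h1.2⟩, rfl⟩
    rcases h1.2 with h | h
    · rcases h1.1.2.1.lt_or_eq with h' | h'
      · exact h'
      · have h2 : H (q r).1 ≤ Φ (q r).2 (q r).1 := h
        rw [← h', hΦ0] at h2
        linarith [hHp _ ha]
    · have : (q r).2 = S := h
      rw [this]; exact hS
  have hmin : ∀ r a u, r ∈ Ioc (0:ℝ) R → r ≤ a → (a, u) ∈ C a → s r ≤ (r / a) ^ b * u := by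
    intro r a u hr hra h
    exact (hq r hr).2 (a, u) ⟨⟨⟨hra, h.1.1.2⟩, h.1.2⟩, h.2⟩
  have hpow : ∀ r a ρ : ℝ, 0 < r → 0 < a → 0 < ρ → (r / ρ) ^ b = (r / a) ^ b * (a / ρ) ^ b := by
    intro r a ρ h1 h2 h3
    rw [← Real.mul_rpow (by positivity) (by positivity)]
    congr 1; field_simp
  have P1 : ∀ r ∈ Ioc (0:ℝ) R, 0 < s r ∧ s r ≤ S := by
    intro r hr
    obtain ⟨a, u, hra, haR, hu, huS, hC, he⟩ := hs r hr
    have ha := hr.1.trans_le hra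
    refine ⟨?_, ?_⟩
    · rw [he]; exact mul_pos (Real.rpow_pos_of_pos (div_pos hr.1 ha) _) hu
    · have := hmin r r S hr le_rfl ⟨⟨⟨le_rfl, hr.2⟩, ⟨hS.le, le_rfl⟩⟩, Or.inr rfl⟩
      rwa [div_self hr.1.ne', Real.one_rpow, one_mul] at this
  have P2 : ∀ r ρ, 0 < r → r ≤ ρ → ρ ≤ R → s r ≤ (r / ρ) ^ b * s ρ := by
    intro r ρ hr hrρ hρ
    have hρ0 := hr.trans_le hrρ
    obtain ⟨a, u, hra, haR, hu, huS, hC, he⟩ := hs ρ ⟨hρ0, hρ⟩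
    rw [he, ← mul_assoc, ← hpow r ρ a hr hρ0 (hρ0.trans_le hra)]
    exact hmin r a u ⟨hr, hrρ.trans hρ⟩ (hrρ.trans hra) hC
  have P4 : ∀ r ∈ Ioc (0:ℝ) R, Φ (s r) r ≤ H r := by
    intro r hr
    by_contra hcon
    push Not at hcon
    have hp := P1 r hr
    have hcc : ContinuousOn (fun u => Φ u r) (Icc 0 (s r)) :=
      (hΦc.comp (continuous_id.prodMk continuous_const)).continuousOn
    have := intermediate_value_Icc hp.1.le hcc
    obtain ⟨u, hu, hue⟩ := this (show H r ∈ _ from ⟨by simp only [hΦ0]; exact (hHp r hr.1).le, hcon.le⟩)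
    have h2 := hmin r r u hr le_rfl ⟨⟨⟨le_rfl, hr.2⟩, ⟨hu.1, hu.2.trans hp.2⟩⟩, Or.inl hue.ge⟩
    rw [div_self hr.1.ne', Real.one_rpow, one_mul] at h2
    have : u = s r := le_antisymm hu.2 h2
    rw [← this] at hcon
    exact absurd hue hcon.ne'
  have hbE' : ∀ x : ℝ, 0 < x → x ≤ 1 → x ^ E ≤ x ^ b := fun x h0 h1 =>
    Real.rpow_le_rpow_of_exponent_ge h0 h1 hbE
  have P3 : ∀ r ρ, 0 < r → r ≤ ρ → ρ ≤ R → (r / ρ) ^ E * s ρ ≤ s r := by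
    intro r ρ hr hrρ hρ
    have hρ0 := hr.trans_le hrρ
    have hsρ := P1 ρ ⟨hρ0, hρ⟩
    obtain ⟨a, u, hra, haR, hu, huS, hC, he⟩ := hs r ⟨hr, hrρ.trans hρ⟩
    have ha := hr.trans_le hra
    rw [he]
    rcases le_or_gt ρ a with h | h
    · rw [hpow r ρ a hr hρ0 ha, mul_assoc]
      exact mul_le_mul (hbE' _ (by positivity) (div_le_one_of_le₀ hrρ hρ0.le))
        (hmin ρ a u ⟨hρ0, hρ⟩ h hC) hsρ.1.le (by positivity)
    · have key : (a / ρ) ^ E * s ρ ≤ u := by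
        have hx1 : (a / ρ) ^ E ≤ 1 := Real.rpow_le_one (by positivity)
          (div_le_one_of_le₀ h.le hρ0.le) (hb.le.trans hbE)
        have hx0 : 0 < (a / ρ) ^ E := by positivity
        rcases hC.2 with h' | h'
        · have h2 : H a ≤ Φ u a := h'
          by_contra hcon
          push Not at hcon
          set v := (a / ρ) ^ E * s ρ with hv
          have hv0 : 0 < v := mul_pos hx0 hsρ.1
          have e1 : Φ v a ≤ H a := by
            calc Φ v a ≤ ((a / ρ) ^ E) ^ 2 * Φ (s ρ) a := hΦs _ _ _ hx0.le hx1 hsρ.1.le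
              _ ≤ ((a / ρ) ^ E) ^ 2 * Φ (s ρ) ρ := by
                  gcongr; exact hΦm _ _ _ hsρ.1.le h.le
              _ ≤ ((a / ρ) ^ E) ^ 2 * H ρ := by
                  gcongr; exact P4 ρ ⟨hρ0, hρ⟩
              _ = H a := (hHs a ρ ha h.le).symm
          have e2 : Φ u a ≤ (u / v) ^ 2 * Φ v a := by
            have := hΦs (u / v) v a (by positivity) (div_le_one_of_le₀ hcon.le hv0.le) hv0.le
            rwa [div_mul_cancel₀ _ hv0.ne'] at this
          have e3 : (u / v) ^ 2 < 1 := by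
            have : u / v < 1 := (div_lt_one hv0).2 hcon
            have h0 : 0 < u / v := by positivity
            nlinarith
          have e4 := hHp a ha
          have e5 : (u / v) ^ 2 * Φ v a ≤ (u / v) ^ 2 * H a := by gcongr
          nlinarith
        · have : u = S := h'
          rw [this]
          nlinarith [hsρ.1, hsρ.2]
      have e : (r / ρ) ^ E = (r / a) ^ E * (a / ρ) ^ E := by
        rw [← Real.mul_rpow (by positivity) (by positivity)]
        congr 1; field_simp
      rw [e, mul_assoc]
      exact mul_le_mul (hbE' _ (by positivity) (div_le_one_of_le₀ hra ha.le)) key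
        (mul_nonneg (by positivity) hsρ.1.le) (by positivity)
  refine ⟨s, P1, P2, P3, P4, ?_⟩
  intro r ρ hr hrρ hρ hlt
  have hρ0 := hr.trans_le hrρ
  have hsρ := P1 ρ ⟨hρ0, hρ⟩
  obtain ⟨a, u, hra, haR, hu, huS, hC, he⟩ := hs r ⟨hr, hrρ.trans hρ⟩
  have ha := hr.trans_le hra
  have haρ : a < ρ := by
    by_contra h
    push Not at h
    have := hmin ρ a u ⟨hρ0, hρ⟩ h hC
    rw [he, hpow r ρ a hr hρ0 ha, mul_assoc] at hlt
    have h2 : (r / ρ) ^ b * s ρ ≤ (r / ρ) ^ b * ((ρ / a) ^ b * u) := by gcongr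
    linarith
  refine ⟨a, ⟨hra, haρ⟩, ?_⟩
  have hsa : s a = u := by
    apply le_antisymm
    · have := hmin a a u ⟨ha, haR⟩ le_rfl hC
      rwa [div_self ha.ne', Real.one_rpow, one_mul] at this
    · have := P2 r a hr hra haR
      rw [he] at this
      exact le_of_mul_le_mul_left this (by positivity)
  apply le_antisymm (P4 a ⟨ha, haR⟩)
  rcases hC.2 with h' | h'
  · rw [hsa]; exact h'
  · exfalso
    have h2 : u = S := h'
    have h3 := P2 a ρ ha haρ.le hρ
    have h4 : (a / ρ) ^ b ≤ 1 := Real.rpow_le_one (by positivity)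
          (div_le_one_of_le₀ haρ.le hρ0.le) hb.le
    rw [he, hpow r a ρ hr ha hρ0, mul_assoc] at hlt
    have h5 := lt_of_mul_lt_mul_left hlt (by positivity)
    nlinarith

theorem contF {n : ℕ} (hn : 1 ≤ n) (t : ℝ) (x : En n) (g : ℝ × En n → ℝ) (hg : Integrable g) :
    Continuous (fun q : ℝ × ℝ => ∫ z in cylSR q.1 q.2 (t, x), g z) := by
  have : Nonempty (Fin n) := ⟨⟨0, hn⟩⟩
  have hm : ∀ q : ℝ × ℝ, MeasurableSet (cylSR q.1 q.2 (t, x)) := fun q =>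
    measurableSet_Ioo.prod measurableSet_ball
  simp_rw [← fun q : ℝ × ℝ => integral_indicator (f := g) (μ := volume) (hm q)]
  rw [continuous_iff_continuousAt]
  intro q₀
  refine continuousAt_of_dominated (bound := fun z => ‖g z‖) ?_ ?_ hg.norm ?_
  · exact Eventually.of_forall fun q => hg.aestronglyMeasurable.indicator (hm q)
  · exact Eventually.of_forall fun q => Eventually.of_forall fun z => norm_indicator_le_norm_self _ _
  have h1 : ∀ᵐ z : ℝ × En n, z.1 ≠ t - q₀.1 := by
    have : ∀ᵐ y : ℝ, y ≠ t - q₀.1 := by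
      rw [ae_iff]; simp
    exact (Measure.quasiMeasurePreserving_fst (μ := (volume : Measure ℝ))
      (ν := (volume : Measure (En n)))).ae this
  have h2 : ∀ᵐ z : ℝ × En n, dist z.2 x ≠ q₀.2 := by
    have : ∀ᵐ y : En n, dist y x ≠ q₀.2 := by
      rw [ae_iff]
      simpa [sphere] using Measure.addHaar_sphere (volume : Measure (En n)) x q₀.2
    exact (Measure.quasiMeasurePreserving_snd (μ := (volume : Measure ℝ))
      (ν := (volume : Measure (En n)))).ae this
  filter_upwards [h1, h2] with z hz1 hz2
  have c1 : Tendsto (fun q : ℝ × ℝ => t - q.1) (𝓝 q₀) (𝓝 (t - q₀.1)) :=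
    (continuous_const.sub continuous_fst).tendsto q₀
  have c2 : Tendsto (fun q : ℝ × ℝ => q.2) (𝓝 q₀) (𝓝 q₀.2) := continuous_snd.tendsto q₀
  have d1 : ∀ᶠ q in 𝓝 q₀, (t - q.1 < z.1 ↔ t - q₀.1 < z.1) := by
    rcases lt_or_gt_of_ne hz1 with h | h
    · filter_upwards [c1.eventually_const_lt h] with q hq
      exact ⟨fun h' => absurd h' hq.not_gt, fun h' => absurd h' h.not_gt⟩
    · filter_upwards [c1.eventually_lt_const h] with q hq
      exact ⟨fun _ => h, fun _ => hq⟩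
  have d2 : ∀ᶠ q in 𝓝 q₀, (dist z.2 x < q.2 ↔ dist z.2 x < q₀.2) := by
    rcases lt_or_gt_of_ne hz2 with h | h
    · filter_upwards [c2.eventually_const_lt h] with q hq
      exact ⟨fun _ => h, fun _ => hq⟩
    · filter_upwards [c2.eventually_lt_const h] with q hq
      exact ⟨fun h' => absurd h' hq.not_gt, fun h' => absurd h' h.not_gt⟩
  refine ContinuousAt.congr (f := fun _ => (cylSR q₀.1 q₀.2 (t, x)).indicator g z) continuousAt_const ?_
  filter_upwards [d1, d2] with q hq1 hq2
  have : z ∈ cylSR q₀.1 q₀.2 (t, x) ↔ z ∈ cylSR q.1 q.2 (t, x) := by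
    simp only [cylSR, mem_prod, mem_Ioo, mem_ball, hq1, hq2]
  by_cases hz : z ∈ cylSR q₀.1 q₀.2 (t, x)
  · rw [indicator_of_mem hz, indicator_of_mem (this.1 hz)]
  · rw [indicator_of_notMem hz, indicator_of_notMem (fun h => hz (this.2 h))]

theorem cylSR_mono {n : ℕ} (z : ℝ × En n) {u u' a a' : ℝ} (hu : u ≤ u') (ha : a ≤ a') :
    cylSR u a z ⊆ cylSR u' a' z :=
  prod_mono (Ioo_subset_Ioo_left (by linarith)) (ball_subset_ball ha)

theorem vol_cyl {n : ℕ} (hn : 1 ≤ n) (z : ℝ × En n) (u a : ℝ) (ha : 0 ≤ a) :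
    volume (cylSR u a z) = ENNReal.ofReal u *
      (ENNReal.ofReal (a ^ n) * volume (ball (0 : En n) 1)) := by
  have : Nonempty (Fin n) := ⟨⟨0, hn⟩⟩
  rw [cylSR, Measure.volume_eq_prod, Measure.prod_prod, Real.volume_Ioo,
    Measure.addHaar_ball _ _ ha]
  simp

/-- comparison of the mean with the power of `λ` -/
theorem mean_compare {p s a V F : ℝ} (hp : 2 < p) (hs : 0 < s) (ha : 0 < a) (hV : 0 < V)
    (hF : 0 ≤ F) :
    ((s * V)⁻¹ * F ≤ ((a ^ 2 / s) ^ (1 / (p - 2))) ^ p ↔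
      F ^ (p - 2) * s ^ 2 ≤ a ^ (2 * p) * V ^ (p - 2)) ∧
    ((s * V)⁻¹ * F = ((a ^ 2 / s) ^ (1 / (p - 2))) ^ p ↔
      F ^ (p - 2) * s ^ 2 = a ^ (2 * p) * V ^ (p - 2)) := by
  have hp2 : 0 < p - 2 := by linarith
  set X := (s * V)⁻¹ * F with hX
  set Y := ((a ^ 2 / s) ^ (1 / (p - 2))) ^ p with hY
  have hX0 : 0 ≤ X := by positivity
  have hY0 : 0 ≤ Y := by positivity
  set k := s ^ p * V ^ (p - 2) with hk
  have hk0 : 0 < k := by positivity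
  have e1 : F ^ (p - 2) * s ^ 2 = X ^ (p - 2) * k := by
    have hFX : F = s * V * X := by rw [hX]; field_simp
    have hsp : s ^ p = s ^ (p - 2) * s ^ 2 := by
      rw [← Real.rpow_natCast s 2, ← Real.rpow_add hs]; norm_num
    rw [hFX, Real.mul_rpow (by positivity) hX0, Real.mul_rpow hs.le hV.le, hk, hsp]
    ring
  have e2 : a ^ (2 * p) * V ^ (p - 2) = Y ^ (p - 2) * k := by
    have : Y ^ (p - 2) = (a ^ 2 / s) ^ p := by
      rw [hY, ← Real.rpow_mul (by positivity), ← Real.rpow_mul (by positivity)]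
      congr 1; field_simp
    rw [this, Real.div_rpow (by positivity) hs.le, Real.rpow_mul ha.le, hk]
    have h2 : a ^ (2:ℝ) = a ^ 2 := by exact_mod_cast Real.rpow_natCast a 2
    rw [h2]
    have : s ^ p ≠ 0 := by positivity
    field_simp
  rw [e1, e2]
  refine ⟨?_, ?_⟩
  · rw [mul_le_mul_iff_left₀ hk0, Real.rpow_le_rpow_iff hX0 hY0 hp2]
  · rw [mul_left_inj' hk0.ne', Real.rpow_left_inj hX0 hY0 hp2.ne']


/-- **Lemma 4.1 (construction of a scaled family of sub-intrinsic cylinders).** -/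
theorem intrinsic_family_existence
    (n N : ℕ) (hn : 1 ≤ n) (hN : 1 ≤ N) (p : ℝ) (hp : 2 < p) :
    ∃ c : ℝ, 0 < c ∧
      ∀ (QT : Set (ℝ × En n)), IsOpen QT →
      ∀ (f : ℝ × En n → Mat N n), IntegrableOn (fun z => ‖f z‖ ^ p) QT →
      ∀ (t : ℝ) (x : En n) (S R : ℝ), 0 < S → 0 < R →
        Ioo (t - S) t ×ˢ ball x R ⊆ QT →
      ∀ b ∈ Ioo (0:ℝ) 2,
      ∃ s : ℝ → ℝ,
        (∀ r ∈ Ioc (0:ℝ) R, 0 < s r ∧ s r ≤ S) ∧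
        -- (1)
        (∀ r ∈ Ioc (0:ℝ) R, s r = lamOf p s r ^ (2 - p) * r ^ 2 ∧
          cylSR (s r) r (t, x) ⊆ QT) ∧
        -- (2)
        (∀ r ρ : ℝ, 0 < r → r < ρ → ρ ≤ R → s r ≤ (r / ρ) ^ b * s ρ) ∧
        ContinuousOn s (Ioc 0 R) ∧ StrictMonoOn s (Ioc 0 R) ∧
        Tendsto s (nhdsWithin 0 (Ioi 0)) (nhds 0) ∧
        (∀ r ρ : ℝ, 0 < r → r < ρ → ρ ≤ R →
          cylSR (s r) r (t, x) ⊆ cylSR (s ρ) ρ (t, x)) ∧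
        -- (3) sub-intrinsic
        (∀ r ∈ Ioc (0:ℝ) R, (⨍ z in cylSR (s r) r (t, x), ‖f z‖ ^ p) ≤ lamOf p s r ^ p) ∧
        -- (4)
        (∀ r ρ : ℝ, 0 < r → r < ρ → ρ ≤ R → s r < (r / ρ) ^ b * s ρ →
          ∃ r₁ ∈ Ico r ρ,
            (⨍ z in cylSR (s r₁) r₁ (t, x), ‖f z‖ ^ p) = lamOf p s r₁ ^ p) ∧
        -- (5)
        (∀ r₁ ρ : ℝ, 0 < r₁ → r₁ ≤ ρ → ρ ≤ R →
          (∀ a ∈ Ioo r₁ ρ, (⨍ z in cylSR (s a) a (t, x), ‖f z‖ ^ p) < lamOf p s a ^ p) →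
          ∀ a ∈ Icc r₁ ρ,
            lamOf p s a ≤ (a / ρ) ^ ((2 - b) / (p - 2)) * lamOf p s ρ) ∧
        -- (6)
        (∀ r ∈ Ioc (0:ℝ) R, ∀ θ ∈ Ioc (0:ℝ) 1,
          θ ^ ((2 - b) / (p - 2)) * lamOf p s r ≤ lamOf p s (θ * r) ∧
          lamOf p s (θ * r) ≤ c * lamOf p s r / θ ^ (((n : ℝ) + 2) / 2)) ∧
        -- (7)
        (∀ r ∈ Ioc (0:ℝ) R, ∀ θ ∈ Ioc (0:ℝ) 1,
          (volume (cylSR (s (θ * r)) (θ * r) (t, x)))⁻¹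
            ≤ ENNReal.ofReal (c * θ ^ (-(((n : ℝ) + 2) * (1 + (p - 2) / 2)))) *
              (volume (cylSR (s r) r (t, x)))⁻¹) ∧
        -- (8)
        (∀ r ∈ Ioc (0:ℝ) R, ∀ θ ∈ Ioc (0:ℝ) 1,
          cylSR (s (θ ^ (2 / b) * r)) (θ ^ (2 / b) * r) (t, x)
            ⊆ cylQ p (lamOf p s r) (θ * r) (t, x)) := by
  have : Nonempty (Fin n) := ⟨⟨0, hn⟩⟩
  have hp2 : 0 < p - 2 := by linarith
  refine ⟨1, one_pos, ?_⟩
  intro QT hQT f hf t x S R hS hR hsub b hb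
  set ω : ℝ := (volume (ball (0 : En n) 1)).toReal with hω
  have hω0 : 0 < ω := ENNReal.toReal_pos (measure_ball_pos _ _ one_pos).ne' measure_ball_lt_top.ne
  have hωe : volume (ball (0 : En n) 1) = ENNReal.ofReal ω :=
    (ENNReal.ofReal_toReal measure_ball_lt_top.ne).symm
  let g : ℝ × En n → ℝ := QT.indicator (fun z => ‖f z‖ ^ p)
  have hg : Integrable g := (integrable_indicator_iff hQT.measurableSet).2 hf
  have hg0 : ∀ z, 0 ≤ g z := fun z => indicator_nonneg (fun z _ => by positivity) z
  let F : ℝ → ℝ → ℝ := fun u a => ∫ z in cylSR u a (t, x), g z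
  have hFc : Continuous (fun q : ℝ × ℝ => F q.1 q.2) := contF hn t x g hg
  have hF0 : ∀ u a, 0 ≤ F u a := fun u a => integral_nonneg hg0
  have hFm : ∀ u u' a a', u ≤ u' → a ≤ a' → F u a ≤ F u' a' := by
    intro u u' a a' hu ha
    exact setIntegral_mono_set hg.integrableOn (Eventually.of_forall hg0)
      (cylSR_mono _ hu ha).eventuallyLE
  set E : ℝ := p + n * (p - 2) / 2 with hE
  have hE2 : 2 < E := by
    have : 0 ≤ n * (p - 2) / 2 := by positivity
    linarith
  obtain ⟨s, P1, P2, P3, P4, P5⟩ := abs_family S R b E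
    (fun u a => F u a ^ (p - 2) * u ^ 2) (fun a => a ^ (2 * p) * (a ^ n * ω) ^ (p - 2))
    hS hb.1 (by linarith [hb.2])
    ((hFc.rpow_const fun _ => Or.inr hp2.le).mul (continuous_fst.pow 2))
    ((Real.continuous_rpow_const (by linarith)).mul
      (((continuous_id.pow n).mul continuous_const).rpow_const fun _ => Or.inr hp2.le))
    (by intro a; simp)
    (by
      intro u a a' hu haa
      have := Real.rpow_le_rpow (hF0 u a) (hFm u u a a' le_rfl haa) hp2.le
      exact mul_le_mul_of_nonneg_right this (by positivity))
    (by
      intro θ u a h0 h1 hu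
      have := Real.rpow_le_rpow (hF0 (θ * u) a) (hFm (θ * u) u a a (by nlinarith) le_rfl) hp2.le
      have h2 := mul_le_mul_of_nonneg_right this (sq_nonneg (θ * u))
      calc _ ≤ _ := h2
        _ = _ := by ring)
    (by intro a ha; positivity)
    (by
      intro a ρ ha haρ
      have hρ := ha.trans_le haρ
      have key : ((a / ρ) ^ E) ^ 2 = (a / ρ) ^ (2 * p) * ((a / ρ) ^ n) ^ (p - 2) := by
        rw [← Real.rpow_natCast (a / ρ) n, ← Real.rpow_mul (by positivity),
          ← Real.rpow_add (by positivity), ← Real.rpow_mul_natCast (by positivity)]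
        congr 1; rw [hE]; push_cast; ring
      have h1 : a ^ (2 * p) = (a / ρ) ^ (2 * p) * ρ ^ (2 * p) := by
        rw [← Real.mul_rpow (by positivity) hρ.le, div_mul_cancel₀ _ hρ.ne']
      have h2 : a ^ n * ω = (a / ρ) ^ n * (ρ ^ n * ω) := by
        rw [div_pow]; field_simp
      rw [key, h1, h2, Real.mul_rpow (by positivity) (by positivity)]
      ring)
  -- basic facts
  have hcylQT : ∀ r ∈ Ioc (0:ℝ) R, cylSR (s r) r (t, x) ⊆ QT := fun r hr =>
    (cylSR_mono (t, x) (P1 r hr).2 hr.2).trans hsub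
  have hmean : ∀ r ∈ Ioc (0:ℝ) R, (⨍ z in cylSR (s r) r (t, x), ‖f z‖ ^ p)
      = (s r * (r ^ n * ω))⁻¹ * F (s r) r := by
    intro r hr
    have hs := (P1 r hr).1
    have hi : ∫ z in cylSR (s r) r (t, x), ‖f z‖ ^ p = F (s r) r := by
      refine setIntegral_congr_fun (measurableSet_Ioo.prod measurableSet_ball) ?_
      intro z hz
      exact (indicator_of_mem (hcylQT r hr hz) (fun z => ‖f z‖ ^ p)).symm
    rw [setAverage_eq, hi, smul_eq_mul, measureReal_def, vol_cyl hn _ _ _ hr.1.le, hωe,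
      ENNReal.toReal_mul, ENNReal.toReal_mul, ENNReal.toReal_ofReal hs.le,
      ENNReal.toReal_ofReal (pow_nonneg hr.1.le n), ENNReal.toReal_ofReal hω0.le]
  have hcmp := fun r (hr : r ∈ Ioc (0:ℝ) R) => mean_compare (F := F (s r) r) hp (P1 r hr).1 hr.1
    (show 0 < r ^ n * ω from mul_pos (pow_pos hr.1 n) hω0) (hF0 _ _)
  have hlam : ∀ r ∈ Ioc (0:ℝ) R, s r = lamOf p s r ^ (2 - p) * r ^ 2 := by
    intro r hr
    have hs := (P1 r hr).1
    have hr0 := hr.1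
    have h : lamOf p s r ^ (2 - p) = (r ^ 2 / s r) ^ (-1 : ℝ) := by
      rw [lamOf, ← Real.rpow_mul (by positivity)]
      congr 1; field_simp; ring
    rw [h, Real.rpow_neg_one]; field_simp
  have hup : ∀ r ρ : ℝ, ∀ e : ℝ, 0 < r → r ≤ ρ → ρ ≤ R → (r / ρ) ^ e * s ρ ≤ s r →
      lamOf p s r ≤ (r / ρ) ^ ((2 - e) / (p - 2)) * lamOf p s ρ := by
    intro r ρ e hr hrρ hρ h
    have hρ0 := hr.trans_le hrρ
    have s1 := (P1 r ⟨hr, hrρ.trans hρ⟩).1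
    have s2 := (P1 ρ ⟨hρ0, hρ⟩).1
    rw [lamOf, lamOf, div_eq_mul_one_div (2 - e), Real.rpow_mul (by positivity),
      ← Real.mul_rpow (by positivity) (by positivity)]
    apply Real.rpow_le_rpow (by positivity) _ (by positivity)
    have e1 : (r / ρ) ^ (2 - e) = (r / ρ) ^ 2 / (r / ρ) ^ e := by
      rw [Real.rpow_sub (by positivity)]; congr 1; exact_mod_cast Real.rpow_natCast _ 2
    have e2 : (r / ρ) ^ (2 - e) * (ρ ^ 2 / s ρ) = r ^ 2 / ((r / ρ) ^ e * s ρ) := by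
      rw [e1, div_pow]; field_simp
    rw [e2]
    gcongr
  have hlow : ∀ r ρ : ℝ, ∀ e : ℝ, 0 < r → r ≤ ρ → ρ ≤ R → s r ≤ (r / ρ) ^ e * s ρ →
      (r / ρ) ^ ((2 - e) / (p - 2)) * lamOf p s ρ ≤ lamOf p s r := by
    intro r ρ e hr hrρ hρ h
    have hρ0 := hr.trans_le hrρ
    have s1 := (P1 r ⟨hr, hrρ.trans hρ⟩).1
    have s2 := (P1 ρ ⟨hρ0, hρ⟩).1
    rw [lamOf, lamOf, div_eq_mul_one_div (2 - e), Real.rpow_mul (by positivity),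
      ← Real.mul_rpow (by positivity) (by positivity)]
    apply Real.rpow_le_rpow (by positivity) _ (by positivity)
    have e1 : (r / ρ) ^ (2 - e) = (r / ρ) ^ 2 / (r / ρ) ^ e := by
      rw [Real.rpow_sub (by positivity)]; congr 1; exact_mod_cast Real.rpow_natCast _ 2
    have e2 : (r / ρ) ^ (2 - e) * (ρ ^ 2 / s ρ) = r ^ 2 / ((r / ρ) ^ e * s ρ) := by
      rw [e1, div_pow]; field_simp
    rw [e2]
    gcongr
  have hmono : StrictMonoOn s (Ioc 0 R) := by
    intro r hr ρ hρ hlt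
    have h1 := P2 r ρ hr.1 hlt.le hρ.2
    have h2 : (r / ρ) ^ b < 1 :=
      Real.rpow_lt_one (div_pos hr.1 hρ.1).le ((div_lt_one hρ.1).2 hlt) hb.1
    nlinarith [(P1 ρ hρ).1]
  have hcont : ContinuousOn s (Ioc 0 R) := by
    intro r₀ hr₀
    have hE0 : 0 < E := by linarith
    have key : ∀ e : ℝ, Tendsto (fun r : ℝ => (r / r₀) ^ e * s r₀) (𝓝[Ioc 0 R] r₀) (𝓝 (s r₀)) := by
      intro e
      have h0 : ContinuousAt (fun r : ℝ => (r / r₀) ^ e * s r₀) r₀ := by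
        refine ContinuousAt.mul ?_ continuousAt_const
        exact (continuousAt_id.div_const r₀).rpow_const (Or.inl (by simp [hr₀.1.ne']))
      have h1 := h0.tendsto
      rw [div_self hr₀.1.ne', Real.one_rpow, one_mul] at h1
      exact h1.mono_left nhdsWithin_le_nhds
    have kmin := (key b).min (key E)
    have kmax := (key b).max (key E)
    rw [min_self] at kmin
    rw [max_self] at kmax
    have hinv : ∀ (r e : ℝ), 0 < r → (r / r₀) ^ e * (r₀ / r) ^ e = 1 := by
      intro r e hr
      have := hr₀.1
      rw [← Real.mul_rpow (by positivity) (by positivity)]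
      have : r / r₀ * (r₀ / r) = 1 := by field_simp
      rw [this, Real.one_rpow]
    refine tendsto_of_tendsto_of_tendsto_of_le_of_le' kmin kmax ?_ ?_
    · filter_upwards [self_mem_nhdsWithin] with r hr
      rcases le_total r r₀ with h | h
      · exact (min_le_right _ _).trans (P3 r r₀ hr.1 h hr₀.2)
      · refine (min_le_left _ _).trans ?_
        have h2 := P2 r₀ r hr₀.1 h hr.2
        have h3 : 0 < (r / r₀) ^ b := Real.rpow_pos_of_pos (div_pos hr.1 hr₀.1) _
        calc (r / r₀) ^ b * s r₀ ≤ (r / r₀) ^ b * ((r₀ / r) ^ b * s r) := by gcongr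
          _ = s r := by rw [← mul_assoc, hinv r b hr.1, one_mul]
    · filter_upwards [self_mem_nhdsWithin] with r hr
      rcases le_total r r₀ with h | h
      · exact (P2 r r₀ hr.1 h hr₀.2).trans (le_max_left _ _)
      · refine le_trans ?_ (le_max_right _ _)
        have h2 := P3 r₀ r hr₀.1 h hr.2
        have h3 : 0 < (r / r₀) ^ E := Real.rpow_pos_of_pos (div_pos hr.1 hr₀.1) _
        calc s r = (r / r₀) ^ E * ((r₀ / r) ^ E * s r) := by
              rw [← mul_assoc, hinv r E hr.1, one_mul]
          _ ≤ (r / r₀) ^ E * s r₀ := by gcongr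
  have hθ : ∀ r ∈ Ioc (0:ℝ) R, ∀ θ ∈ Ioc (0:ℝ) 1, 0 < θ * r ∧ θ * r ≤ r ∧ θ * r / r = θ := by
    intro r hr θ hθ
    refine ⟨mul_pos hθ.1 hr.1, by nlinarith [hr.1, hθ.2], ?_⟩
    rw [mul_div_assoc, div_self hr.1.ne', mul_one]
  have h4 : ∀ r ρ : ℝ, 0 < r → r < ρ → ρ ≤ R → s r < (r / ρ) ^ b * s ρ →
      ∃ r₁ ∈ Ico r ρ,
        (⨍ z in cylSR (s r₁) r₁ (t, x), ‖f z‖ ^ p) = lamOf p s r₁ ^ p := by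
    intro r ρ hr hrρ hρ hlt
    obtain ⟨r₁, h1, h2⟩ := P5 r ρ hr hrρ.le hρ hlt
    have hr1 : r₁ ∈ Ioc (0:ℝ) R := ⟨hr.trans_le h1.1, h1.2.le.trans hρ⟩
    refine ⟨r₁, h1, ?_⟩
    rw [hmean r₁ hr1]
    exact (hcmp r₁ hr1).2.2 h2
  refine ⟨s, P1, fun r hr => ⟨hlam r hr, hcylQT r hr⟩, fun r ρ h1 h2 h3 => P2 r ρ h1 h2.le h3,
    hcont, hmono, ?_, ?_, ?_, h4, ?_, ?_, ?_, ?_⟩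
  · -- limit
    have h0 : Tendsto (fun r : ℝ => (r / R) ^ b * s R) (𝓝[>] 0) (𝓝 0) := by
      have hc : Continuous (fun r : ℝ => (r / R) ^ b * s R) :=
        ((continuous_id.div_const R).rpow_const fun _ => Or.inr hb.1.le).mul continuous_const
      have := hc.tendsto 0
      rw [zero_div, Real.zero_rpow hb.1.ne', zero_mul] at this
      exact this.mono_left nhdsWithin_le_nhds
    have hev : ∀ᶠ r in 𝓝[>] (0:ℝ), r ∈ Ioc (0:ℝ) R := Ioc_mem_nhdsGT hR
    refine tendsto_of_tendsto_of_tendsto_of_le_of_le' tendsto_const_nhds h0 ?_ ?_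
    · filter_upwards [hev] with r hr using (P1 r hr).1.le
    · filter_upwards [hev] with r hr using P2 r R hr.1 hr.2 le_rfl
  · intro r ρ h1 h2 h3
    exact cylSR_mono _ (hmono ⟨h1, h2.le.trans h3⟩ ⟨h1.trans h2, h3⟩ h2).le h2.le
  · intro r hr
    rw [hmean r hr]
    exact (hcmp r hr).1.2 (P4 r hr)
  · -- (5)
    intro r₁ ρ hr1 hr1ρ hρ hlt a ha
    have hρ0 := hr1.trans_le hr1ρ
    have ha0 := hr1.trans_le ha.1
    refine hup a ρ b ha0 ha.2 hρ ?_
    have main : ∀ a, r₁ < a → a < ρ → (a / ρ) ^ b * s ρ ≤ s a := by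
      intro a h1 h2
      by_contra hcon
      push Not at hcon
      obtain ⟨r₂, h3, h5⟩ := h4 a ρ (hr1.trans h1) h2 hρ hcon
      exact (hlt r₂ ⟨h1.trans_le h3.1, h3.2⟩).ne h5
    rcases ha.2.lt_or_eq with h | h
    · rcases ha.1.lt_or_eq with h' | h'
      · exact main a h' h
      · subst h'
        have hsub' : Ioo r₁ ρ ⊆ Ioc 0 R := fun y hy => ⟨hr1.trans hy.1, hy.2.le.trans hρ⟩
        have t1 : Tendsto s (𝓝[Ioo r₁ ρ] r₁) (𝓝 (s r₁)) :=
          (hcont r₁ ⟨hr1, hr1ρ.trans hρ⟩).mono_left (nhdsWithin_mono _ hsub')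
        have t2 : Tendsto (fun a : ℝ => (a / ρ) ^ b * s ρ) (𝓝[Ioo r₁ ρ] r₁)
            (𝓝 ((r₁ / ρ) ^ b * s ρ)) := by
          have hc : Continuous (fun r : ℝ => (r / ρ) ^ b * s ρ) :=
            ((continuous_id.div_const ρ).rpow_const fun _ => Or.inr hb.1.le).mul continuous_const
          exact (hc.tendsto r₁).mono_left nhdsWithin_le_nhds
        have : (𝓝[Ioo r₁ ρ] r₁).NeBot := left_nhdsWithin_Ioo_neBot h
        refine le_of_tendsto_of_tendsto t2 t1 ?_
        filter_upwards [self_mem_nhdsWithin] with y hy using main y hy.1 hy.2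
    · rw [h, div_self hρ0.ne', Real.one_rpow, one_mul]
  · -- (6)
    intro r hr θ hθ1
    obtain ⟨k1, k2, k3⟩ := hθ r hr θ hθ1
    constructor
    · have := hlow (θ * r) r b k1 k2 hr.2 (P2 _ _ k1 k2 hr.2)
      rwa [k3] at this
    · have := hup (θ * r) r E k1 k2 hr.2 (P3 _ _ k1 k2 hr.2)
      rw [k3] at this
      refine this.trans_eq ?_
      have he : (2 - E) / (p - 2) = -(((n : ℝ) + 2) / 2) := by
        rw [hE]; field_simp; ring
      rw [he, Real.rpow_neg hθ1.1.le, one_mul, mul_comm]; rfl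
  · -- (7)
    intro r hr θ hθ1
    obtain ⟨k1, k2, k3⟩ := hθ r hr θ hθ1
    have s1 := (P1 r hr).1
    have s2 := (P1 (θ * r) ⟨k1, k2.trans hr.2⟩).1
    have hr0 := hr.1
    have hθ0 := hθ1.1
    have h3 := P3 _ _ k1 k2 hr.2
    rw [k3] at h3
    rw [vol_cyl hn _ _ _ k1.le, vol_cyl hn _ _ _ hr.1.le, hωe,
      ← ENNReal.ofReal_mul (by positivity), ← ENNReal.ofReal_mul (by positivity),
      ← ENNReal.ofReal_mul (by positivity), ← ENNReal.ofReal_mul (by positivity),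
      ← ENNReal.ofReal_inv_of_pos (by positivity), ← ENNReal.ofReal_inv_of_pos (by positivity),
      ← ENNReal.ofReal_mul (by positivity)]
    apply ENNReal.ofReal_le_ofReal
    have he : θ ^ (-(((n : ℝ) + 2) * (1 + (p - 2) / 2))) = (θ ^ E * θ ^ n)⁻¹ := by
      rw [Real.rpow_neg hθ0.le, ← Real.rpow_natCast θ n, ← Real.rpow_add hθ0]
      congr 2; rw [hE]; ring
    rw [he, one_mul, ← mul_inv]
    apply inv_anti₀ (by positivity)
    calc θ ^ E * θ ^ n * (s r * (r ^ n * ω)) = (θ ^ E * s r) * ((θ * r) ^ n * ω) := by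
          rw [mul_pow]; ring
      _ ≤ _ := by gcongr
  · -- (8)
    intro r hr θ hθ1
    have hb2 : 1 ≤ 2 / b := by rw [le_div_iff₀ hb.1]; linarith [hb.2]
    have hσ : θ ^ (2 / b) ∈ Ioc (0:ℝ) 1 :=
      ⟨Real.rpow_pos_of_pos hθ1.1 _, Real.rpow_le_one hθ1.1.le hθ1.2 (by linarith)⟩
    have hσθ : θ ^ (2 / b) ≤ θ := by
      simpa using Real.rpow_le_rpow_of_exponent_ge hθ1.1 hθ1.2 hb2
    obtain ⟨k1, k2, k3⟩ := hθ r hr _ hσ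
    have h2 := P2 _ _ k1 k2 hr.2
    have hb0 := hb.1.ne'
    have he : (θ ^ (2 / b)) ^ b = θ ^ 2 := by
      rw [← Real.rpow_mul hθ1.1.le, div_mul_cancel₀ _ hb0]
      exact_mod_cast Real.rpow_natCast θ 2
    rw [k3, he] at h2
    have hQ : cylQ p (lamOf p s r) (θ * r) (t, x) = cylSR (θ ^ 2 * s r) (θ * r) (t, x) := by
      have : lamOf p s r ^ (2 - p) * (θ * r) ^ 2 = θ ^ 2 * s r := by
        conv_rhs => rw [hlam r hr]
        ring
      simp only [cylQ, cylSR, this]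
    rw [hQ]
    exact cylSR_mono _ h2 (mul_le_mul_of_nonneg_right hσθ hr.1.le)


end
end

section
/- Let (X,μ) be a measure space, let Q ⊂ X be measurable with 0 < μ(Q) < ∞, let Q₁ ⊂ Q be measurable with μ(Q₁) > 0, let q ∈ [1,∞), f ∈ L^q(Q), and ε ∈ (0,1). If |⟨f⟩_{Q₁}| ≤ ε ⟨|f|^q⟩_Q^{1/q}, then |⟨f⟩_{Q₁}| ≤ ε ⟨|f|^q⟩_Q^{1/q} ≤ (ε/(1−ε)) (1 + (μ(Q)/μ(Q₁))^{1/q}) (⨍_Q |f − ⟨f⟩_Q|^q dμ)^{1/q}. -/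
open MeasureTheory Metric Set Filter
open scoped ENNReal NNReal RealInnerProductSpace Topology

noncomputable section

theorem aux_toReal {X E : Type*} [MeasurableSpace X] [NormedAddCommGroup E]
    (ν : Measure X) (q : ℝ) (hq : 1 ≤ q) (g : X → E)
    (hg : MemLp g (ENNReal.ofReal q) ν) :
    (∫ x, ‖g x‖ ^ q ∂ν) ^ (1 / q) = (eLpNorm g (ENNReal.ofReal q) ν).toReal := by
  have hq0 : 0 < q := by linarith
  rw [hg.eLpNorm_eq_integral_rpow_norm (by simpa using hq0) ENNReal.ofReal_ne_top,
    ENNReal.toReal_ofReal hq0.le, ENNReal.toReal_ofReal, one_div]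
  exact Real.rpow_nonneg (integral_nonneg fun x => Real.rpow_nonneg (norm_nonneg _) _) _

theorem aux_triangle {X E : Type*} [MeasurableSpace X] [NormedAddCommGroup E]
    (ν : Measure X) [IsProbabilityMeasure ν] (q : ℝ) (hq : 1 ≤ q) (g : X → E)
    (hg : MemLp g (ENNReal.ofReal q) ν) (a : E) :
    (∫ x, ‖g x‖ ^ q ∂ν) ^ (1 / q) ≤ (∫ x, ‖g x - a‖ ^ q ∂ν) ^ (1 / q) + ‖a‖ := by
  have hq0 : 0 < q := by linarith
  have hc : MemLp (fun _ : X => a) (ENNReal.ofReal q) ν := memLp_const a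
  have hs : MemLp (fun x => g x - a) (ENNReal.ofReal q) ν := hg.sub hc
  have h1 : (1 : ℝ≥0∞) ≤ ENNReal.ofReal q := by simpa using hq
  have ha : ‖a‖ = (eLpNorm (fun _ : X => a) (ENNReal.ofReal q) ν).toReal := by
    rw [← aux_toReal ν q hq _ hc]
    simp only [integral_const, probReal_univ, one_smul]
    rw [← Real.rpow_mul (norm_nonneg _), mul_one_div_cancel hq0.ne', Real.rpow_one]
  rw [aux_toReal ν q hq g hg, aux_toReal ν q hq _ hs, ha,
    ← ENNReal.toReal_add hs.eLpNorm_ne_top hc.eLpNorm_ne_top]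
  refine ENNReal.toReal_mono (ENNReal.add_ne_top.2 ⟨hs.eLpNorm_ne_top, hc.eLpNorm_ne_top⟩) ?_
  have h := eLpNorm_add_le hs.1 hc.1 h1
  have e : (fun x => g x - a) + (fun _ : X => a) = g := by
    funext x; simp
  rwa [e] at h

theorem aux_jensen {X E : Type*} [MeasurableSpace X] [NormedAddCommGroup E] [NormedSpace ℝ E]
    (ν : Measure X) [IsProbabilityMeasure ν] (q : ℝ) (hq : 1 ≤ q) (g : X → E)
    (hg : MemLp g (ENNReal.ofReal q) ν) :
    ‖∫ x, g x ∂ν‖ ≤ (∫ x, ‖g x‖ ^ q ∂ν) ^ (1 / q) := by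
  have h1 : (1 : ℝ≥0∞) ≤ ENNReal.ofReal q := by simpa using hq
  rw [aux_toReal ν q hq g hg]
  refine (norm_integral_le_integral_norm g).trans ?_
  have h := aux_toReal ν 1 le_rfl g (by simpa using hg.mono_exponent h1)
  simp only [Real.rpow_one, div_one, ENNReal.ofReal_one] at h
  rw [h]
  exact ENNReal.toReal_mono hg.eLpNorm_ne_top (eLpNorm_le_eLpNorm_of_exponent_le h1 hg.1)


/-- **Lemma A.1 (best-constant-type estimate for small means).** -/
theorem small_mean_estimate
    {X : Type*} [MeasurableSpace X] (μ : Measure X) {m : ℕ}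
    (Q Q₁ : Set X) (hQ : MeasurableSet Q) (hQ₁ : MeasurableSet Q₁) (hsub : Q₁ ⊆ Q)
    (hμQpos : 0 < μ Q) (hμQfin : μ Q < ⊤) (hμQ₁pos : 0 < μ Q₁)
    (q : ℝ) (hq : 1 ≤ q) (f : X → EuclideanSpace ℝ (Fin m))
    (hf : MemLp f (ENNReal.ofReal q) (μ.restrict Q))
    (ε : ℝ) (hε : ε ∈ Ioo (0:ℝ) 1)
    (hsmall : ‖⨍ x in Q₁, f x ∂μ‖ ≤ ε * (⨍ x in Q, ‖f x‖ ^ q ∂μ) ^ (1 / q)) :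
    ‖⨍ x in Q₁, f x ∂μ‖ ≤ ε * (⨍ x in Q, ‖f x‖ ^ q ∂μ) ^ (1 / q) ∧
    ε * (⨍ x in Q, ‖f x‖ ^ q ∂μ) ^ (1 / q)
      ≤ (ε / (1 - ε)) * (1 + ((μ Q).toReal / (μ Q₁).toReal) ^ (1 / q)) *
          (⨍ x in Q, ‖f x - ⨍ w in Q, f w ∂μ‖ ^ q ∂μ) ^ (1 / q) := by
  refine ⟨hsmall, ?_⟩
  obtain ⟨hε0, hε1⟩ := hε
  have hq0 : 0 < q := by linarith
  have h1 : (1 : ℝ≥0∞) ≤ ENNReal.ofReal q := by simpa using hq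
  have hμQ₁fin : μ Q₁ < ⊤ := (measure_mono hsub).trans_lt hμQfin
  have hfin : IsFiniteMeasure (μ.restrict Q) := ⟨by simpa using hμQfin⟩
  have hfin₁ : IsFiniteMeasure (μ.restrict Q₁) := ⟨by simpa using hμQ₁fin⟩
  have hP : IsProbabilityMeasure ((μ Q)⁻¹ • μ.restrict Q) :=
    ⟨by simpa using ENNReal.inv_mul_cancel hμQpos.ne' hμQfin.ne⟩
  have hP₁ : IsProbabilityMeasure ((μ Q₁)⁻¹ • μ.restrict Q₁) :=
    ⟨by simpa using ENNReal.inv_mul_cancel hμQ₁pos.ne' hμQ₁fin.ne⟩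
  have hf₁ : MemLp f (ENNReal.ofReal q) (μ.restrict Q₁) :=
    hf.mono_measure (Measure.restrict_mono hsub le_rfl)
  have hν := hf.smul_measure (ENNReal.inv_ne_top.2 hμQpos.ne')
  have hν₁ := hf₁.smul_measure (ENNReal.inv_ne_top.2 hμQ₁pos.ne')
  set a := ⨍ w in Q, f w ∂μ with ha
  set b := ⨍ w in Q₁, f w ∂μ with hb
  have hga : MemLp (fun x => f x - a) (ENNReal.ofReal q) (μ.restrict Q) :=
    hf.sub (memLp_const a)
  have T := aux_triangle _ q hq f hν a
  rw [← setAverage_eq', ← setAverage_eq'] at T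
  have J := aux_jensen _ q hq (fun x => f x - a) (hν₁.sub (memLp_const a))
  rw [← setAverage_eq' μ (fun x => ‖f x - a‖ ^ q)] at J
  rw [integral_sub (hν₁.integrable h1) (integrable_const a), ← setAverage_eq'] at J
  simp only [integral_const, probReal_univ, one_smul] at J
  rw [← hb] at J
  have hQr : 0 < μ.real Q := ENNReal.toReal_pos hμQpos.ne' hμQfin.ne
  have hQ₁r : 0 < μ.real Q₁ := ENNReal.toReal_pos hμQ₁pos.ne' hμQ₁fin.ne
  have hint : IntegrableOn (fun x => ‖f x - a‖ ^ q) Q μ := by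
    have := hga.integrable_norm_rpow'
    rwa [ENNReal.toReal_ofReal hq0.le] at this
  have hnn : ∀ x, 0 ≤ ‖f x - a‖ ^ q := fun x => Real.rpow_nonneg (norm_nonneg _) _
  have M : (⨍ x in Q₁, ‖f x - a‖ ^ q ∂μ)
      ≤ (μ.real Q / μ.real Q₁) * ⨍ x in Q, ‖f x - a‖ ^ q ∂μ := by
    rw [setAverage_eq, setAverage_eq, smul_eq_mul, smul_eq_mul]
    have := setIntegral_mono_set hint (Eventually.of_forall hnn)
      (Eventually.of_forall hsub : Q₁ ≤ᵐ[μ] Q)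
    calc _ ≤ (μ.real Q₁)⁻¹ * ∫ x in Q, ‖f x - a‖ ^ q ∂μ := by gcongr
      _ = _ := by field_simp
  have hA : 0 ≤ ⨍ x in Q, ‖f x - a‖ ^ q ∂μ := by
    rw [setAverage_eq']; exact integral_nonneg hnn
  have hA₁ : 0 ≤ ⨍ x in Q₁, ‖f x - a‖ ^ q ∂μ := by
    rw [setAverage_eq']; exact integral_nonneg hnn
  have M' := Real.rpow_le_rpow hA₁ M (by positivity : 0 ≤ 1 / q)
  rw [Real.mul_rpow (by positivity) hA] at M'
  change _ ≤ (ε / (1 - ε)) * (1 + (μ.real Q / μ.real Q₁) ^ (1 / q)) * _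
  have hab : ‖a‖ ≤ ‖b - a‖ + ‖b‖ := by
    have := norm_sub_norm_le a b
    rw [norm_sub_rev] at this
    linarith
  generalize (⨍ x in Q, ‖f x‖ ^ q ∂μ) ^ (1 / q) = N at *
  generalize (⨍ x in Q, ‖f x - a‖ ^ q ∂μ) ^ (1 / q) = D at *
  generalize (μ.real Q / μ.real Q₁) ^ (1 / q) = c at *
  have h1e : 0 < 1 - ε := by linarith
  have key : (1 - ε) * N ≤ (1 + c) * D := by nlinarith
  have : N ≤ (1 + c) * D / (1 - ε) := by
    rw [le_div_iff₀ h1e]; linarith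
  calc ε * N ≤ ε * ((1 + c) * D / (1 - ε)) := by gcongr
    _ = _ := by ring

end
end

section
/- Let q ∈ [1,∞), let B ⊂ ℝ^d be a ball, f ∈ L^q(B;ℝ^m), and let ω : (0,1) → (0,∞) be increasing with ∑_{i=1}^∞ ω(2^{−i}) ≤ K < ∞. Suppose there is c₁ > 0 such that for every ball B' concentric-contained in B (i.e. B' = θ''B for some positive scaling of a subball of B, in the sense that the hypothesis holds for all balls B' ⊆ B) and every θ ∈ (0,1): (⨍_{θB'} |f − ⟨f⟩_{θB'}|^q dx)^{1/q} ≤ c₁ ω(θ) (⨍_{B'} |f − ⟨f⟩_{B'}|^q dx)^{1/q}, where θB' is the concentric ball with radius scaled by θ. Then for every θ ∈ (0,1/2), the essential oscillation of f over θB satisfies ess osc_{θB} f ≤ c K ω(θ) (⨍_B |f − ⟨f⟩_B|^q dx)^{1/q}, with c depending only on q, d and c₁. In particular, if ω(θ) = θ^γ for some γ ∈ (0,1), the conclusion holds with K depending only on γ. -/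
open MeasureTheory Metric Set Filter
open scoped ENNReal NNReal RealInnerProductSpace Topology

noncomputable section

namespace OscDecay

section abstractPart

variable {α F : Type*} [MeasurableSpace α] [NormedAddCommGroup F] [NormedSpace ℝ F]
  [CompleteSpace F]

lemma lpNorm_le_of_le_smul {μ ν : Measure α} {L : ℝ≥0} (hL : 1 ≤ L) (hle : ν ≤ L • μ)
    {p : ℝ≥0∞} (hp : 1 ≤ p) {g : α → F} (hg : MemLp g p μ) :
    lpNorm g p ν ≤ L * lpNorm g p μ := by
  have hle' : ν ≤ (L : ℝ≥0∞) • μ := hle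
  have hgν : MemLp g p ν := hg.of_measure_le_smul ENNReal.coe_ne_top hle'
  have h1 : eLpNorm g p ν ≤ (L : ℝ≥0∞) * eLpNorm g p μ := by
    refine (eLpNorm_mono_measure g hle').trans ?_
    rw [eLpNorm_smul_measure_of_ne_zero (by positivity), smul_eq_mul]
    gcongr
    have : (1 / p).toReal ≤ 1 := by
      have : (1 / p) ≤ 1 := by simpa using hp
      simpa using ENNReal.toReal_mono (by simp) this
    calc (L : ℝ≥0∞) ^ (1 / p).toReal ≤ (L : ℝ≥0∞) ^ (1 : ℝ) :=
          ENNReal.rpow_le_rpow_of_exponent_le (by exact_mod_cast hL) this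
      _ = L := ENNReal.rpow_one _
  rw [← toReal_eLpNorm hg.1, ← toReal_eLpNorm hgν.1]
  have := ENNReal.toReal_mono (ENNReal.mul_ne_top ENNReal.coe_ne_top hg.2.ne) h1
  simpa using this

lemma norm_integral_sub_le {ν : Measure α} [IsProbabilityMeasure ν] {p : ℝ≥0∞} (hp : 1 ≤ p)
    {f : α → F} (hf : MemLp f p ν) (a : F) :
    ‖(∫ x, f x ∂ν) - a‖ ≤ lpNorm (fun x => f x - a) p ν := by
  have hg : MemLp (fun x => f x - a) p ν := hf.sub (memLp_const a)
  have hfi : Integrable f ν := hf.integrable hp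
  have h1 : (∫ x, f x ∂ν) - a = ∫ x, (f x - a) ∂ν := by
    rw [integral_sub hfi (integrable_const a)]; simp
  rw [h1]
  refine (norm_integral_le_integral_norm _).trans ?_
  rw [← lpNorm_one_eq_integral_norm hg.1, ← toReal_eLpNorm hg.1, ← toReal_eLpNorm hg.1]
  exact ENNReal.toReal_mono hg.2.ne (eLpNorm_le_eLpNorm_of_exponent_le hp hg.1)

lemma compare_abs {μ ν : Measure α} [IsProbabilityMeasure μ] [IsProbabilityMeasure ν]
    {L : ℝ≥0} (hL : 1 ≤ L) (hle : ν ≤ L • μ)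
    {p : ℝ≥0∞} (hp : 1 ≤ p) {f : α → F} (hf : MemLp f p μ) :
    ‖(∫ x, f x ∂ν) - ∫ x, f x ∂μ‖ ≤ L * lpNorm (fun x => f x - ∫ w, f w ∂μ) p μ ∧
    lpNorm (fun x => f x - ∫ w, f w ∂ν) p ν
      ≤ 2 * L * lpNorm (fun x => f x - ∫ w, f w ∂μ) p μ := by
  have hle' : ν ≤ (L : ℝ≥0∞) • μ := hle
  have hfν : MemLp f p ν := hf.of_measure_le_smul ENNReal.coe_ne_top hle'
  set a := ∫ x, f x ∂μ
  have hg : MemLp (fun x => f x - a) p μ := hf.sub (memLp_const a)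
  have hgν : MemLp (fun x => f x - a) p ν := hfν.sub (memLp_const a)
  have h1 := norm_integral_sub_le hp hfν a
  have h2 := lpNorm_le_of_le_smul hL hle hp hg
  refine ⟨h1.trans h2, ?_⟩
  set b := ∫ x, f x ∂ν
  have h3 : lpNorm (fun x => f x - b) p ν
      ≤ lpNorm (fun x => f x - a) p ν + lpNorm (fun _ : α => b - a) p ν := by
    have := lpNorm_sub_le hgν (g := fun _ : α => b - a) hp
    convert this using 2
    ext x; simp
  rw [lpNorm_const (by positivity) (IsProbabilityMeasure.ne_zero ν)] at h3
  simp at h3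
  linarith

end abstractPart

variable {d m : ℕ}

/-- mean over a ball -/
def Av (f : En d → En m) (y : En d) (ρ : ℝ) : En m := ⨍ w in ball y ρ, f w

/-- `L^q` mean oscillation over a ball -/
def Phi (q : ℝ) (f : En d → En m) (y : En d) (ρ : ℝ) : ℝ :=
  (⨍ x in ball y ρ, ‖f x - ⨍ w in ball y ρ, f w‖ ^ q) ^ (1 / q)

/-- normalized measure on a ball -/
def nu (y : En d) (ρ : ℝ) : Measure (En d) :=
  (volume (ball y ρ))⁻¹ • volume.restrict (ball y ρ)

lemma nu_prob (y : En d) {ρ : ℝ} (hρ : 0 < ρ) : IsProbabilityMeasure (nu y ρ) := by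
  constructor
  simp only [nu, Measure.smul_apply, Measure.restrict_apply MeasurableSet.univ, univ_inter,
    smul_eq_mul]
  exact ENNReal.inv_mul_cancel (measure_ball_pos _ _ hρ).ne' measure_ball_lt_top.ne

lemma Av_eq (f : En d → En m) (y : En d) (ρ : ℝ) : Av f y ρ = ∫ x, f x ∂(nu y ρ) :=
  setAverage_eq' _ _ _

lemma memLp_nu {f : En d → En m} {p : ℝ≥0∞} {y : En d} {ρ : ℝ} (hρ : 0 < ρ)
    (hf : MemLp f p (volume.restrict (ball y ρ))) : MemLp f p (nu y ρ) :=
  hf.smul_measure (ENNReal.inv_ne_top.2 (measure_ball_pos _ _ hρ).ne')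

lemma Phi_eq {q : ℝ} (hq : 1 ≤ q) {f : En d → En m} {y : En d} {ρ : ℝ} (hρ : 0 < ρ)
    (hf : MemLp f (ENNReal.ofReal q) (volume.restrict (ball y ρ))) :
    Phi q f y ρ = lpNorm (fun x => f x - ∫ w, f w ∂(nu y ρ)) (ENNReal.ofReal q) (nu y ρ) := by
  have := nu_prob y hρ
  have hg : MemLp (fun x => f x - ∫ w, f w ∂(nu y ρ)) (ENNReal.ofReal q) (nu y ρ) :=
    (memLp_nu hρ hf).sub (memLp_const _)
  rw [lpNorm_eq_integral_norm_rpow_toReal (by simp; linarith) (by simp) hg.1,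
    ENNReal.toReal_ofReal (by linarith)]
  unfold Phi
  rw [setAverage_eq', setAverage_eq', one_div]
  rfl

lemma Phi_nonneg (q : ℝ) (f : En d → En m) (y : En d) (ρ : ℝ) : 0 ≤ Phi q f y ρ := by
  unfold Phi
  refine Real.rpow_nonneg ?_ _
  rw [setAverage_eq']
  exact integral_nonneg fun x => Real.rpow_nonneg (norm_nonneg _) _

lemma nu_le {z y : En d} {s r : ℝ} (hs : 0 < s) (hr : r ≤ 4 * s) (hsub : ball z s ⊆ ball y r)
    (hr0 : 0 < r) :
    nu z s ≤ ((4 : ℝ≥0) ^ d) • nu y r := by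
  have hv : volume (ball y r) ≤ (4 : ℝ≥0∞) ^ d * volume (ball z s) := by
    rw [Measure.addHaar_ball_of_pos _ _ hs, Measure.addHaar_ball_of_pos _ _ hr0, ← mul_assoc]
    gcongr
    have : (4 : ℝ≥0∞) ^ d = ENNReal.ofReal (4 ^ d) := by
      rw [ENNReal.ofReal_pow (by norm_num)]; norm_num
    rw [this, ← ENNReal.ofReal_mul (by positivity)]
    apply ENNReal.ofReal_le_ofReal
    simp only [finrank_euclideanSpace, Fintype.card_fin]
    rw [← mul_pow]
    gcongr
  have hz0 := (measure_ball_pos volume z hs).ne'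
  have hzt := (measure_ball_lt_top (μ := volume) (x := z) (r := s)).ne
  have hy0 := (measure_ball_pos volume y hr0).ne'
  have hyt := (measure_ball_lt_top (μ := volume) (x := y) (r := r)).ne
  have hinv : (volume (ball z s))⁻¹ ≤ (4 : ℝ≥0∞) ^ d * (volume (ball y r))⁻¹ := by
    rw [← div_eq_mul_inv, ENNReal.le_div_iff_mul_le (Or.inl hy0) (Or.inl hyt), mul_comm]
    rw [← div_eq_mul_inv, ENNReal.div_le_iff hz0 hzt]
    exact hv
  intro A
  have h1 : volume.restrict (ball z s) A ≤ volume.restrict (ball y r) A :=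
    Measure.restrict_mono hsub le_rfl A
  simp only [nu, Measure.smul_apply, smul_eq_mul, ENNReal.smul_def]
  push_cast
  rw [← mul_assoc]
  gcongr

lemma compare {q : ℝ} (hq : 1 ≤ q) {f : En d → En m} {z y : En d} {s r : ℝ} (hs : 0 < s)
    (hr : r ≤ 4 * s) (hsub : ball z s ⊆ ball y r) (hr0 : 0 < r)
    (hf : MemLp f (ENNReal.ofReal q) (volume.restrict (ball y r))) :
    ‖Av f z s - Av f y r‖ ≤ 4 ^ d * Phi q f y r ∧
      Phi q f z s ≤ 2 * 4 ^ d * Phi q f y r := by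
  have := nu_prob y hr0
  have := nu_prob z hs
  have hfz : MemLp f (ENNReal.ofReal q) (volume.restrict (ball z s)) :=
    hf.mono_measure (Measure.restrict_mono hsub le_rfl)
  have h := compare_abs (one_le_pow₀ (by norm_num)) (nu_le hs hr hsub hr0)
    (p := ENNReal.ofReal q) (by simpa using hq) (memLp_nu hr0 hf)
  rw [Phi_eq hq hr0 hf, Phi_eq hq hs hfz, Av_eq, Av_eq]
  simpa using h

/-- Lebesgue differentiation along dyadic radii. -/
lemma lebesgue (hd : 1 ≤ d) {q : ℝ} (hq : 1 ≤ q) {f : En d → En m} {y₀ : En d} {R : ℝ}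
    (hf : MemLp f (ENNReal.ofReal q) (volume.restrict (ball y₀ R))) :
    ∀ᵐ x : En d, x ∈ ball y₀ R → ∀ s : ℝ, 0 < s →
      Tendsto (fun k : ℕ => Av f x ((2:ℝ)⁻¹ ^ k * s)) atTop (𝓝 (f x)) := by
  have : IsFiniteMeasure (volume.restrict (ball y₀ R)) :=
    ⟨by simpa using measure_ball_lt_top⟩
  have hfi : IntegrableOn f (ball y₀ R) := hf.integrable (by simpa using hq)
  have hgi : Integrable ((ball y₀ R).indicator f) :=
    (integrable_indicator_iff measurableSet_ball).2 hfi
  have : Nonempty (Fin d) := ⟨⟨0, hd⟩⟩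
  have : Nontrivial (En d) := inferInstance
  filter_upwards [IsUnifLocDoublingMeasure.ae_tendsto_average volume hgi.locallyIntegrable 1]
    with x hx hxB s hs
  have hlim0 : Tendsto (fun k : ℕ => (2:ℝ)⁻¹ ^ k * s) atTop (𝓝 0) := by
    simpa using (tendsto_pow_atTop_nhds_zero_of_lt_one (r := (2:ℝ)⁻¹) (by norm_num)
      (by norm_num)).mul_const s
  have hlim : Tendsto (fun k : ℕ => (2:ℝ)⁻¹ ^ k * s) atTop (𝓝[>] 0) :=
    tendsto_nhdsWithin_iff.2 ⟨hlim0, Eventually.of_forall fun k => by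
      simp only [mem_Ioi]; positivity⟩
  have h := hx (fun _ => x) _ hlim (Eventually.of_forall fun k => by
    apply mem_closedBall_self; positivity)
  rw [indicator_of_mem hxB] at h
  refine h.congr' ?_
  obtain ⟨ε, hε, hεB⟩ := Metric.isOpen_iff.1 isOpen_ball x hxB
  filter_upwards [hlim0.eventually (gt_mem_nhds hε)] with k hk
  unfold Av
  have h1 : (closedBall x ((2:ℝ)⁻¹ ^ k * s) : Set (En d)) =ᵐ[volume] ball x ((2:ℝ)⁻¹ ^ k * s) := by
    refine (ae_eq_of_subset_of_measure_ge ball_subset_closedBall ?_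
      measurableSet_ball.nullMeasurableSet measure_closedBall_lt_top.ne).symm
    rw [Measure.addHaar_closedBall_eq_addHaar_ball]
  rw [setAverage_congr h1]
  refine setAverage_congr_fun measurableSet_ball (Eventually.of_forall fun w hw => ?_)
  exact indicator_of_mem (hεB (ball_subset_ball hk.le hw)) f

/-- two overlapping balls of the same radius -/
lemma step {q : ℝ} (hq : 1 ≤ q) {f : En d → En m} {x z : En d} {s : ℝ} (hs : 0 < s)
    (hxz : dist x z ≤ s / 2)
    (hfx : MemLp f (ENNReal.ofReal q) (volume.restrict (ball x s)))
    (hfz : MemLp f (ENNReal.ofReal q) (volume.restrict (ball z s))) :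
    ‖Av f x s - Av f z s‖ ≤ 4 ^ d * (Phi q f x s + Phi q f z s) := by
  have h1 := (compare hq (z := x) (y := x) (s := s / 2) (r := s) (by linarith) (by linarith)
    (ball_subset_ball (by linarith)) hs hfx).1
  have h2 := (compare hq (z := x) (y := z) (s := s / 2) (r := s) (by linarith) (by linarith)
    (ball_subset_ball' (by linarith)) hs hfz).1
  rw [norm_sub_rev] at h1
  have := norm_sub_le_norm_sub_add_norm_sub (Av f x s) (Av f x (s / 2)) (Av f z s)
  linarith

/-- overlapping balls of radius `ρ/2` at `x` and `ρ` at `y`, `x ∈ B_ρ(y)`. -/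
lemma step2 {q : ℝ} (hq : 1 ≤ q) {f : En d → En m} {x y : En d} {ρ : ℝ} (hρ : 0 < ρ)
    (hxy : dist x y ≤ ρ)
    (hfx : MemLp f (ENNReal.ofReal q) (volume.restrict (ball x (ρ / 2))))
    (hfy : MemLp f (ENNReal.ofReal q) (volume.restrict (ball y ρ))) :
    ‖Av f x (ρ / 2) - Av f y ρ‖ ≤ 4 ^ d * (Phi q f x (ρ / 2) + Phi q f y ρ) := by
  set z : En d := AffineMap.lineMap x y (1 / 4 : ℝ)
  have hzx : dist z x ≤ ρ / 4 := by
    rw [dist_lineMap_left]; norm_num; linarith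
  have hzy : dist z y ≤ 3 * ρ / 4 := by
    rw [dist_lineMap_right]; norm_num; linarith
  have h1 := (compare hq (z := z) (y := x) (s := ρ / 4) (r := ρ / 2) (by linarith) (by linarith)
    (ball_subset_ball' (by linarith)) (by linarith) hfx).1
  have h2 := (compare hq (z := z) (y := y) (s := ρ / 4) (r := ρ) (by linarith) (by linarith)
    (ball_subset_ball' (by linarith)) hρ hfy).1
  rw [norm_sub_rev] at h1
  have := norm_sub_le_norm_sub_add_norm_sub (Av f x (ρ / 2)) (Av f z (ρ / 4)) (Av f y ρ)
  linarith

/-- Very fast decay of the mean oscillation forces `f` to be constant. -/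
lemma const_case {q : ℝ} (hq : 1 ≤ q) {f : En d → En m} {y₀ : En d} {R : ℝ} (hR : 0 < R)
    (hf : MemLp f (ENNReal.ofReal q) (volume.restrict (ball y₀ R)))
    (hdec : ∀ (y : En d) (ρ : ℝ), 0 < ρ → ball y ρ ⊆ ball y₀ R →
      Phi q f y (2⁻¹ * ρ) ≤ 1 / 4 * Phi q f y ρ)
    {x z : En d} (hx : x ∈ ball y₀ (R / 2)) (hz : z ∈ ball y₀ (R / 2))
    (hLx : Tendsto (fun k : ℕ => Av f x ((2:ℝ)⁻¹ ^ k * (R / 2))) atTop (𝓝 (f x)))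
    (hLz : Tendsto (fun k : ℕ => Av f z ((2:ℝ)⁻¹ ^ k * (R / 2))) atTop (𝓝 (f z))) :
    f x = f z := by
  have hsub : ∀ w ∈ ball y₀ (R / 2), ∀ k : ℕ, ball w ((2:ℝ)⁻¹ ^ k * (R / 2)) ⊆ ball y₀ R := by
    intro w hw k
    refine ball_subset_ball' ?_
    have : (2:ℝ)⁻¹ ^ k ≤ 1 := pow_le_one₀ (by norm_num) (by norm_num)
    rw [mem_ball] at hw
    nlinarith
  set P := 2 * 4 ^ d * Phi q f y₀ R with hP
  have hP0 : 0 ≤ P := by have := Phi_nonneg q f y₀ R; positivity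
  have hPhi : ∀ w ∈ ball y₀ (R / 2), ∀ k : ℕ,
      Phi q f w ((2:ℝ)⁻¹ ^ k * (R / 2)) ≤ (1 / 4) ^ k * P := by
    intro w hw k
    induction k with
    | zero =>
      have := hsub w hw 0
      simp only [pow_zero, one_mul] at this ⊢
      exact (compare hq (by linarith) (by linarith) this hR hf).2
    | succ k ih =>
      have h := hdec w ((2:ℝ)⁻¹ ^ k * (R / 2)) (by positivity) (hsub w hw k)
      have e : (2:ℝ)⁻¹ ^ (k + 1) * (R / 2) = 2⁻¹ * ((2:ℝ)⁻¹ ^ k * (R / 2)) := by ring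
      rw [e]
      calc _ ≤ _ := h
        _ ≤ 1 / 4 * ((1 / 4) ^ k * P) := by gcongr
        _ = _ := by ring
  have hmem : ∀ w ∈ ball y₀ (R / 2), ∀ k : ℕ,
      MemLp f (ENNReal.ofReal q) (volume.restrict (ball w ((2:ℝ)⁻¹ ^ k * (R / 2)))) :=
    fun w hw k => hf.mono_measure (Measure.restrict_mono (hsub w hw k) le_rfl)
  have hchain : ∀ k : ℕ, ‖Av f x ((2:ℝ)⁻¹ ^ k * (R / 2)) - Av f z ((2:ℝ)⁻¹ ^ k * (R / 2))‖
      ≤ (2:ℝ)⁻¹ ^ k * (8 * 4 ^ d * P) := by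
    intro k
    set s := (2:ℝ)⁻¹ ^ k * (R / 2) with hs
    have hs0 : 0 < s := by positivity
    set n : ℕ := 4 * 2 ^ k with hn
    have hn0 : (0:ℝ) < n := by positivity
    have hseg : ∀ j ≤ n, AffineMap.lineMap x z ((j:ℝ) / n) ∈ ball y₀ (R / 2) := by
      intro j hj
      refine (convex_ball y₀ (R / 2)).segment_subset hx hz ?_
      rw [segment_eq_image_lineMap]
      refine ⟨(j:ℝ) / n, ⟨by positivity, ?_⟩, rfl⟩
      rw [div_le_one hn0]; exact_mod_cast hj
    have hxz : dist x z ≤ R := by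
      have := dist_triangle_right x z y₀
      rw [mem_ball] at hx hz; linarith
    have hstep : ∀ j ≤ n, ‖Av f (AffineMap.lineMap x z ((j:ℝ) / n)) s - Av f x s‖
        ≤ j * (4 ^ d * (2 * ((1 / 4) ^ k * P))) := by
      intro j
      induction j with
      | zero => intro _; simp
      | succ j ih =>
        intro hj
        have h1 := ih (by omega)
        have ha := hseg j (by omega)
        have hb := hseg (j + 1) hj
        have h2 := step hq (f := f) (x := AffineMap.lineMap x z (((j + 1 : ℕ) : ℝ) / n))
          (z := AffineMap.lineMap x z ((j:ℝ) / n)) hs0 (by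
            rw [dist_lineMap_lineMap, Real.dist_eq]
            have e : (((j + 1 : ℕ) : ℝ) / n - (j:ℝ) / n) = 1 / n := by push_cast; ring
            rw [e, abs_of_pos (by positivity)]
            have e2 : s / 2 = 1 / n * R := by
              rw [hs, hn]; push_cast; rw [inv_pow]; field_simp; norm_num
            rw [e2]
            gcongr) (hmem _ hb k) (hmem _ ha k)
        have h3 := hPhi _ ha k
        have h4 := hPhi _ hb k
        rw [← hs] at h3 h4
        have h5 := norm_sub_le_norm_sub_add_norm_sub
          (Av f (AffineMap.lineMap x z (((j + 1 : ℕ) : ℝ) / n)) s)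
          (Av f (AffineMap.lineMap x z ((j:ℝ) / n)) s) (Av f x s)
        have h6 : (4:ℝ) ^ d * (Phi q f (AffineMap.lineMap x z (((j + 1 : ℕ) : ℝ) / n)) s
            + Phi q f (AffineMap.lineMap x z ((j:ℝ) / n)) s)
            ≤ 4 ^ d * (2 * ((1 / 4) ^ k * P)) := by
          gcongr; linarith
        push_cast at *
        linarith
    have h := hstep n le_rfl
    rw [div_self hn0.ne', AffineMap.lineMap_apply_one, norm_sub_rev] at h
    refine h.trans (le_of_eq ?_)
    rw [hn]; push_cast
    have e : ((1:ℝ) / 4) ^ k = 2⁻¹ ^ k * 2⁻¹ ^ k := by rw [← mul_pow]; norm_num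
    have e2 : (2:ℝ) ^ k * 2⁻¹ ^ k = 1 := by rw [← mul_pow]; norm_num
    rw [e]
    linear_combination (8 * 4 ^ d * P * 2⁻¹ ^ k) * e2
  have hlim := (hLx.sub hLz).norm
  have h0 : Tendsto (fun k : ℕ => (2:ℝ)⁻¹ ^ k * (8 * 4 ^ d * P)) atTop (𝓝 0) := by
    simpa using (tendsto_pow_atTop_nhds_zero_of_lt_one (r := (2:ℝ)⁻¹) (by norm_num)
      (by norm_num)).mul_const (8 * 4 ^ d * P)
  have := le_of_tendsto_of_tendsto' hlim h0 hchain
  exact sub_eq_zero.1 (norm_le_zero_iff.1 this)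

/-- Pointwise estimate at Lebesgue points. -/
lemma main_case {q : ℝ} (hq : 1 ≤ q) {f : En d → En m} {y₀ : En d} {R : ℝ} (hR : 0 < R)
    (hf : MemLp f (ENNReal.ofReal q) (volume.restrict (ball y₀ R)))
    {c₁ K : ℝ} (hc₁ : 0 < c₁) {ω : ℝ → ℝ} (hω : ∀ a ∈ Ioo (0:ℝ) 1, 0 < ω a)
    (hsum : Summable (fun i : ℕ => ω ((2:ℝ)⁻¹ ^ (i + 1))))
    (hK : (∑' i : ℕ, ω ((2:ℝ)⁻¹ ^ (i + 1))) ≤ K)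
    (hdec : ∀ (y : En d) (ρ : ℝ), 0 < ρ → ball y ρ ⊆ ball y₀ R → ∀ θ ∈ Ioo (0:ℝ) 1,
      Phi q f y (θ * ρ) ≤ c₁ * ω θ * Phi q f y ρ)
    {θ : ℝ} (hθ : θ ∈ Ioo (0:ℝ) (1 / 2)) {x : En d} (hx : x ∈ ball y₀ (θ * R))
    (hLx : Tendsto (fun k : ℕ => Av f x ((2:ℝ)⁻¹ ^ k * (θ * R / 2))) atTop (𝓝 (f x))) :
    ‖f x - Av f y₀ (θ * R)‖
      ≤ (4 ^ d) ^ 2 * (5 + 2 * (c₁ * K)) * (c₁ * ω θ * Phi q f y₀ R) := by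
  obtain ⟨hθ0, hθ1⟩ := hθ
  set ρ := θ * R with hρ
  have hρ0 : 0 < ρ := by positivity
  have hρR : ρ < R / 2 := by rw [hρ]; nlinarith
  rw [mem_ball] at hx
  set L : ℝ := 4 ^ d with hLdef
  have hL1 : 1 ≤ L := one_le_pow₀ (by norm_num)
  have hωpos : ∀ i : ℕ, 0 ≤ ω ((2:ℝ)⁻¹ ^ (i + 1)) := fun i =>
    (hω _ ⟨by positivity, pow_lt_one₀ (by norm_num) (by norm_num) (by omega)⟩).le
  have hK0 : 0 ≤ K := (tsum_nonneg hωpos).trans hK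
  set A := Phi q f x (ρ / 2) with hA
  have hA0 : 0 ≤ A := Phi_nonneg _ _ _ _
  set T := c₁ * ω θ * Phi q f y₀ R with hT
  have hωθ := hω θ ⟨hθ0, by linarith⟩
  have hT0 : 0 ≤ T := by have := Phi_nonneg q f y₀ R; positivity
  -- the scale `ρ/2` at `x`
  have hsubx : ball x (R / 2) ⊆ ball y₀ R := ball_subset_ball' (by linarith)
  have hAT : A ≤ 2 * L * T := by
    have h1 := hdec x (R / 2) (by linarith) hsubx θ ⟨hθ0, by linarith⟩
    have h2 := (compare hq (by linarith) (by linarith) hsubx hR hf).2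
    have e : θ * (R / 2) = ρ / 2 := by rw [hρ]; ring
    rw [e] at h1
    calc A ≤ c₁ * ω θ * Phi q f x (R / 2) := h1
      _ ≤ c₁ * ω θ * (2 * L * Phi q f y₀ R) := by gcongr
      _ = 2 * L * T := by rw [hT]; ring
  have hsub : ∀ k : ℕ, ball x ((2:ℝ)⁻¹ ^ k * (ρ / 2)) ⊆ ball x (ρ / 2) := by
    intro k
    refine ball_subset_ball ?_
    have : (2:ℝ)⁻¹ ^ k ≤ 1 := pow_le_one₀ (by norm_num) (by norm_num)
    nlinarith
  have hsub' : ball x (ρ / 2) ⊆ ball y₀ R := (ball_subset_ball (by linarith)).trans hsubx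
  have hmem0 : MemLp f (ENNReal.ofReal q) (volume.restrict (ball x (ρ / 2))) :=
    hf.mono_measure (Measure.restrict_mono hsub' le_rfl)
  have hmem : ∀ k : ℕ, MemLp f (ENNReal.ofReal q)
      (volume.restrict (ball x ((2:ℝ)⁻¹ ^ k * (ρ / 2)))) :=
    fun k => hmem0.mono_measure (Measure.restrict_mono (hsub k) le_rfl)
  have hinc : ∀ k : ℕ, ‖Av f x ((2:ℝ)⁻¹ ^ (k + 1) * (ρ / 2)) - Av f x ((2:ℝ)⁻¹ ^ k * (ρ / 2))‖
      ≤ L * Phi q f x ((2:ℝ)⁻¹ ^ k * (ρ / 2)) := by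
    intro k
    have h0 : 0 < (2:ℝ)⁻¹ ^ k * (ρ / 2) := by positivity
    have e : (2:ℝ)⁻¹ ^ (k + 1) * (ρ / 2) = (2:ℝ)⁻¹ ^ k * (ρ / 2) / 2 := by ring
    rw [e]
    exact (compare hq (by linarith) (by linarith) (ball_subset_ball (by linarith)) h0
      (hmem k)).1
  have htel : ∀ n : ℕ, ‖Av f x ((2:ℝ)⁻¹ ^ (n + 1) * (ρ / 2)) - Av f x (ρ / 2)‖
      ≤ L * A + L * (c₁ * A) * ∑ i ∈ Finset.range n, ω ((2:ℝ)⁻¹ ^ (i + 1)) := by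
    intro n
    induction n with
    | zero => simpa using hinc 0
    | succ n ih =>
      rw [Finset.sum_range_succ]
      have h1 := hinc (n + 1)
      have h2 := hdec x (ρ / 2) (by linarith) hsub' ((2:ℝ)⁻¹ ^ (n + 1))
        ⟨by positivity, pow_lt_one₀ (by norm_num) (by norm_num) (by omega)⟩
      have h3 := norm_sub_le_norm_sub_add_norm_sub (Av f x ((2:ℝ)⁻¹ ^ (n + 1 + 1) * (ρ / 2)))
        (Av f x ((2:ℝ)⁻¹ ^ (n + 1) * (ρ / 2))) (Av f x (ρ / 2))
      have h4 : L * Phi q f x ((2:ℝ)⁻¹ ^ (n + 1) * (ρ / 2))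
          ≤ L * (c₁ * ω ((2:ℝ)⁻¹ ^ (n + 1)) * A) := by gcongr
      nlinarith
  have hbd : ∀ n : ℕ, ‖Av f x ((2:ℝ)⁻¹ ^ (n + 1) * (ρ / 2)) - Av f x (ρ / 2)‖
      ≤ L * A + L * (c₁ * A) * K := by
    intro n
    refine (htel n).trans ?_
    have := (hsum.sum_le_tsum (Finset.range n) fun i _ => hωpos i).trans hK
    gcongr
  have hlim : ‖f x - Av f x (ρ / 2)‖ ≤ L * A + L * (c₁ * A) * K :=
    le_of_tendsto' (((tendsto_add_atTop_iff_nat 1).2 hLx).sub_const _).norm hbd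
  have hsuby : ball y₀ ρ ⊆ ball y₀ R := ball_subset_ball (by linarith)
  have h2 := step2 hq (f := f) hρ0 hx.le hmem0
    (hf.mono_measure (Measure.restrict_mono hsuby le_rfl))
  have h3 : Phi q f y₀ ρ ≤ T := hdec y₀ R hR le_rfl θ ⟨hθ0, by linarith⟩
  have h4 := norm_sub_le_norm_sub_add_norm_sub (f x) (Av f x (ρ / 2)) (Av f y₀ ρ)
  have h5 : L * (2 + c₁ * K) * A ≤ L * (2 + c₁ * K) * (2 * L * T) := by gcongr
  have h6 : L * Phi q f y₀ ρ ≤ L * T := by gcongr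
  have h7 : L * T ≤ L * (L * T) := by
    have : 0 ≤ L * T := by positivity
    nlinarith
  change ‖Av f x (ρ / 2) - Av f y₀ ρ‖ ≤ L * (A + Phi q f y₀ ρ) at h2
  nlinarith

end OscDecay

/-- **Lemma A.2 (oscillation decay from Dini-type iteration).** -/
theorem oscillation_from_decay
    (q : ℝ) (hq : 1 ≤ q) (d m : ℕ) (hd : 1 ≤ d) (c₁ : ℝ) (hc₁ : 0 < c₁) :
    ∃ c : ℝ, 0 < c ∧
      ∀ (y₀ : En d) (R : ℝ), 0 < R →
      ∀ f : En d → EuclideanSpace ℝ (Fin m),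
        MemLp f (ENNReal.ofReal q) (volume.restrict (ball y₀ R)) →
      ∀ (ω : ℝ → ℝ) (K : ℝ),
        (∀ a b : ℝ, 0 < a → a ≤ b → b < 1 → ω a ≤ ω b) →
        (∀ a ∈ Ioo (0:ℝ) 1, 0 < ω a) →
        Summable (fun i : ℕ => ω ((2:ℝ)⁻¹ ^ (i + 1))) →
        (∑' i : ℕ, ω ((2:ℝ)⁻¹ ^ (i + 1))) ≤ K →
        -- decay hypothesis on all balls contained in `B`
        (∀ (y : En d) (ρ : ℝ), 0 < ρ → ball y ρ ⊆ ball y₀ R →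
          ∀ θ ∈ Ioo (0:ℝ) 1,
            (⨍ x in ball y (θ * ρ), ‖f x - ⨍ w in ball y (θ * ρ), f w‖ ^ q) ^ (1 / q)
              ≤ c₁ * ω θ *
                (⨍ x in ball y ρ, ‖f x - ⨍ w in ball y ρ, f w‖ ^ q) ^ (1 / q)) →
        ∀ θ ∈ Ioo (0:ℝ) (1/2),
          essOsc volume (ball y₀ (θ * R)) f
            ≤ ENNReal.ofReal (c * K * ω θ *
                (⨍ x in ball y₀ R, ‖f x - ⨍ w in ball y₀ R, f w‖ ^ q) ^ (1 / q)) := by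
  refine ⟨44 * (4 ^ d) ^ 2 * c₁ ^ 2, by positivity, ?_⟩
  intro y₀ R hR f hf ω K hmono hω hsum hK hdec0 θ hθ
  have hdec : ∀ (y : En d) (ρ : ℝ), 0 < ρ → ball y ρ ⊆ ball y₀ R → ∀ θ ∈ Ioo (0:ℝ) 1,
      OscDecay.Phi q f y (θ * ρ) ≤ c₁ * ω θ * OscDecay.Phi q f y ρ := hdec0
  change _ ≤ ENNReal.ofReal (44 * (4 ^ d) ^ 2 * c₁ ^ 2 * K * ω θ * OscDecay.Phi q f y₀ R)
  have hsubθ : ball y₀ (θ * R) ⊆ ball y₀ (R / 2) := ball_subset_ball (by nlinarith [hθ.2])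
  have hsubR : ball y₀ (R / 2) ⊆ ball y₀ R := ball_subset_ball (by linarith)
  have hae : ∀ᵐ x ∂(volume.restrict (ball y₀ (θ * R))), x ∈ ball y₀ (θ * R) ∧ ∀ s : ℝ, 0 < s →
      Tendsto (fun k : ℕ => OscDecay.Av f x ((2:ℝ)⁻¹ ^ k * s)) atTop (𝓝 (f x)) := by
    rw [ae_restrict_iff' measurableSet_ball]
    filter_upwards [OscDecay.lebesgue hd hq hf] with x hx hxB
    exact ⟨hxB, hx (hsubR (hsubθ hxB))⟩
  unfold essOsc
  refine essSup_le_of_ae_le _ ?_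
  filter_upwards [Measure.quasiMeasurePreserving_fst.ae hae,
    Measure.quasiMeasurePreserving_snd.ae hae] with zw h1 h2
  apply ENNReal.ofReal_le_ofReal
  have hPhi0 := OscDecay.Phi_nonneg q f y₀ R
  have hωθ := hω θ ⟨hθ.1, by linarith [hθ.2]⟩
  have hωpos : ∀ i : ℕ, 0 ≤ ω ((2:ℝ)⁻¹ ^ (i + 1)) := fun i =>
    (hω _ ⟨by positivity, pow_lt_one₀ (by norm_num) (by norm_num) (by omega)⟩).le
  have hK0 : 0 ≤ K := (tsum_nonneg hωpos).trans hK
  rcases le_or_gt (c₁ * ω 2⁻¹) (1 / 4) with hsmall | hbig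
  · have : f zw.1 = f zw.2 := by
      refine OscDecay.const_case hq hR hf ?_ (hsubθ h1.1) (hsubθ h2.1) (h1.2 _ (by linarith))
        (h2.2 _ (by linarith))
      intro y ρ hρ hsub
      refine (hdec y ρ hρ hsub 2⁻¹ ⟨by norm_num, by norm_num⟩).trans ?_
      have := OscDecay.Phi_nonneg q f y ρ
      gcongr
    rw [this, sub_self, norm_zero]
    positivity
  · have hωK : ω 2⁻¹ ≤ K := by
      have := (hsum.le_tsum 0 fun i _ => hωpos i).trans hK
      simpa using this
    have hcK : 1 ≤ 4 * (c₁ * K) := by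
      have : c₁ * ω 2⁻¹ ≤ c₁ * K := by gcongr
      linarith
    have hρ : 0 < θ * R / 2 := by have := hθ.1; positivity
    have e1 := OscDecay.main_case hq hR hf hc₁ hω hsum hK hdec hθ h1.1 (h1.2 _ hρ)
    have e2 := OscDecay.main_case hq hR hf hc₁ hω hsum hK hdec hθ h2.1 (h2.2 _ hρ)
    rw [norm_sub_rev] at e2
    have e3 := norm_sub_le_norm_sub_add_norm_sub (f zw.1) (OscDecay.Av f y₀ (θ * R)) (f zw.2)
    have e4 : ((4:ℝ) ^ d) ^ 2 * (5 + 2 * (c₁ * K)) * (c₁ * ω θ * OscDecay.Phi q f y₀ R)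
        ≤ (4 ^ d) ^ 2 * (22 * (c₁ * K)) * (c₁ * ω θ * OscDecay.Phi q f y₀ R) := by
      gcongr; linarith
    calc _ ≤ _ := e3
      _ ≤ 2 * ((4 ^ d) ^ 2 * (22 * (c₁ * K)) * (c₁ * ω θ * OscDecay.Phi q f y₀ R)) := by linarith
      _ = _ := by ring

end
end

section
/- Let p ≥ 2 and n, N ≥ 1. There exists a constant c > 0, depending only on p (and n, N), such that for all matrices P, Q ∈ ℝ^{N×n}: |P − Q|^p ≤ c · | |Q|^{(p−2)/2} Q − |P|^{(p−2)/2} P |². -/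
open MeasureTheory Metric Set Filter
open scoped ENNReal NNReal RealInnerProductSpace Topology

noncomputable section

/-- **Inequality (2.4):** for `p ≥ 2`, `|P − Q|^p ≤ c |V(Q) − V(P)|²` with `c = c(p,n,N)`. -/
theorem vmap_coercivity
    (n N : ℕ) (hn : 1 ≤ n) (hN : 1 ≤ N) (p : ℝ) (hp : 2 ≤ p) :
    ∃ c : ℝ, 0 < c ∧
      ∀ P Q : Mat N n, ‖P - Q‖ ^ p ≤ c * ‖Vmap p Q - Vmap p P‖ ^ 2 := by
  set s : ℝ := (p - 2) / 2 with hs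
  have hs0 : 0 ≤ s := by rw [hs]; linarith
  refine ⟨((2:ℝ) ^ s * 2) ^ 2, by positivity, fun P Q => ?_⟩
  unfold Vmap
  rw [← hs]
  have hX : 0 ≤ ‖P‖ ^ s := by positivity
  have hY : 0 ≤ ‖Q‖ ^ s := by positivity
  have hmono : 0 ≤ (‖P‖ ^ s - ‖Q‖ ^ s) * (‖P‖ ^ 2 - ‖Q‖ ^ 2) := by
    rcases le_total ‖P‖ ‖Q‖ with h | h
    · have h1 := Real.rpow_le_rpow (norm_nonneg P) h hs0
      have h2 := pow_le_pow_left₀ (norm_nonneg P) h 2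
      exact mul_nonneg_of_nonpos_of_nonpos (by linarith) (by linarith)
    · have h1 := Real.rpow_le_rpow (norm_nonneg Q) h hs0
      have h2 := pow_le_pow_left₀ (norm_nonneg Q) h 2
      exact mul_nonneg (by linarith) (by linarith)
  have hbd : ‖P - Q‖ ^ s ≤ 2 ^ s * (‖P‖ ^ s + ‖Q‖ ^ s) := by
    have hn0 := norm_sub_le P Q
    have h2 : (0:ℝ) ≤ 2 ^ s := by positivity
    rcases le_total ‖P‖ ‖Q‖ with h | h
    · have h1 := Real.rpow_le_rpow (norm_nonneg (P - Q))
        (show ‖P - Q‖ ≤ 2 * ‖Q‖ by linarith) hs0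
      rw [Real.mul_rpow (by norm_num) (norm_nonneg Q)] at h1
      nlinarith [mul_nonneg h2 hX]
    · have h1 := Real.rpow_le_rpow (norm_nonneg (P - Q))
        (show ‖P - Q‖ ≤ 2 * ‖P‖ by linarith) hs0
      rw [Real.mul_rpow (by norm_num) (norm_nonneg P)] at h1
      nlinarith [mul_nonneg h2 hY]
  have hpow : ‖P - Q‖ ^ p = (‖P - Q‖ ^ s * ‖P - Q‖) ^ 2 := by
    rw [← Real.rpow_add_one' (norm_nonneg _) (by linarith), ← Real.rpow_natCast,
      ← Real.rpow_mul (norm_nonneg _)]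
    congr 1
    rw [hs]; push_cast; ring
  generalize ‖P‖ ^ s = X at *
  generalize ‖Q‖ ^ s = Y at *
  have hin : inner ℝ (X • P - Y • Q) (P - Q)
      = X * ‖P‖ ^ 2 - (X + Y) * inner ℝ P Q + Y * ‖Q‖ ^ 2 := by
    simp only [inner_sub_left, inner_sub_right, real_inner_smul_left,
      real_inner_self_eq_norm_sq, real_inner_comm P Q]
    ring
  have hsq := norm_sub_sq_real P Q
  have hcs := real_inner_le_norm (X • P - Y • Q) (P - Q)
  rw [norm_sub_rev (Y • Q)]
  have hmain : (X + Y) * ‖P - Q‖ ≤ 2 * ‖X • P - Y • Q‖ := by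
    rcases (norm_nonneg (P - Q)).eq_or_lt with h | h
    · rw [← h]; simp
    · refine le_of_mul_le_mul_right ?_ h
      have : (X + Y) * ‖P - Q‖ * ‖P - Q‖ = (X + Y) * ‖P - Q‖ ^ 2 := by ring
      rw [this, hsq]
      rw [hin] at hcs
      nlinarith
  rw [hpow, ← mul_pow]
  apply pow_le_pow_left₀ (by positivity)
  calc ‖P - Q‖ ^ s * ‖P - Q‖ ≤ 2 ^ s * (X + Y) * ‖P - Q‖ := by gcongr
    _ = 2 ^ s * ((X + Y) * ‖P - Q‖) := by ring
    _ ≤ 2 ^ s * (2 * ‖X • P - Y • Q‖) := by gcongr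
    _ = _ := by ring

end
end
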